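/- arXiv:math/0511176 — 5 statements merged into one kernel-verified Lean document; each statement's English description precedes it below -/
import Mathlib

section
/- Let F be a finite extension of ℚ₂ and κ ∈ F* not a square. Then the ramification break number b of the quadratic extension F(√κ)/F satisfies b = 2e_F − def_F(κ), where def_F(κ) is the quadratic defect of κ in F (with def_F(π_F) = 0 for a prime element). -/
def DiscreteVal (F : Type*) [Field F] (v : F → WithTop ℤ) : Prop :=
  v 0 = ⊤ ∧ (∀ x : F, v x = ⊤ → x = 0) ∧ (∀ x y : F, v (x * y) = v x + v y) ∧
    (∀ x y : F, min (v x) (v y) ≤ v (x + y)) ∧ (∃ π : F, v π = 1)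

/-- `d` is the quadratic defect of `κ` in `F`: the maximum of `v (k² κ - 1)` over `k ∈ F`.
(For elements of odd valuation this maximum is `0`, matching the convention
`def_F(π_F) = 0`.) -/
def HasQuadDefect {F : Type*} [Field F] (v : F → WithTop ℤ) (κ : F) (d : WithTop ℤ) : Prop :=
  IsGreatest {n : WithTop ℤ | ∃ k : F, v (k ^ 2 * κ - 1) = n} d

/-- Integer-valued version of a discrete valuation. -/
theorem exists_intVal {F : Type*} [Field F] {v : F → WithTop ℤ} (h : DiscreteVal F v) :
    ∃ V : F → ℤ, (∀ x, x ≠ 0 → v x = ((V x : ℤ) : WithTop ℤ)) ∧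
      (∀ x y, x ≠ 0 → y ≠ 0 → V (x * y) = V x + V y) ∧
      (∀ x y, x ≠ 0 → y ≠ 0 → x + y ≠ 0 → min (V x) (V y) ≤ V (x + y)) := by
  obtain ⟨-, h1, h2, h3, -⟩ := h
  have key : ∀ x, x ≠ 0 → v x = (((v x).untopD 0 : ℤ) : WithTop ℤ) := by
    intro x hx
    have hne : v x ≠ ⊤ := fun h => hx (h1 x h)
    lift v x to ℤ using hne with n
    rfl
  refine ⟨fun x => (v x).untopD 0, key, ?_, ?_⟩
  · intro x y hx hy
    have := h2 x y
    rw [key x hx, key y hy, key _ (mul_ne_zero hx hy)] at this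
    exact_mod_cast this
  · intro x y hx hy hxy
    have := h3 x y
    rw [key x hx, key y hy, key _ hxy] at this
    exact_mod_cast this

section IntVal

variable {E : Type*} [Field E] {V : E → ℤ}

theorem intVal_one (hm : ∀ x y, x ≠ 0 → y ≠ 0 → V (x * y) = V x + V y) : V 1 = 0 := by
  have := hm 1 1 one_ne_zero one_ne_zero
  rw [mul_one] at this
  omega

theorem intVal_neg (hm : ∀ x y, x ≠ 0 → y ≠ 0 → V (x * y) = V x + V y) (x : E) (hx : x ≠ 0) :
    V (-x) = V x := by
  have h1 := intVal_one hm
  have h2 := hm (-1) (-1) (by simp) (by simp)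
  have h3 := hm (-1) x (by simp) hx
  rw [neg_mul_neg, one_mul] at h2
  rw [neg_one_mul] at h3
  omega

theorem intVal_add_of_lt (hm : ∀ x y, x ≠ 0 → y ≠ 0 → V (x * y) = V x + V y)
    (ha : ∀ x y, x ≠ 0 → y ≠ 0 → x + y ≠ 0 → min (V x) (V y) ≤ V (x + y))
    (x y : E) (hx : x ≠ 0) (hy : y ≠ 0) (h : V x < V y) : V (x + y) = V x := by
  have hxy : x + y ≠ 0 := by
    intro h0
    have : y = -x := by linear_combination h0
    rw [this, intVal_neg hm x hx] at h
    omega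
  have h1 := ha x y hx hy hxy
  have h2 := ha (x + y) (-y) hxy (neg_ne_zero.2 hy) (by simpa using hx)
  rw [intVal_neg hm y hy, add_neg_cancel_right] at h2
  omega

theorem intVal_add_of_ne (hm : ∀ x y, x ≠ 0 → y ≠ 0 → V (x * y) = V x + V y)
    (ha : ∀ x y, x ≠ 0 → y ≠ 0 → x + y ≠ 0 → min (V x) (V y) ≤ V (x + y))
    (x y : E) (hx : x ≠ 0) (hy : y ≠ 0) (h : V x ≠ V y) : V (x + y) = min (V x) (V y) := by
  rcases lt_or_gt_of_ne h with h | h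
  · rw [intVal_add_of_lt hm ha x y hx hy h]; omega
  · rw [add_comm, intVal_add_of_lt hm ha y x hy hx h]; omega

end IntVal

theorem exists_coords {F E : Type*} [Field F] [Field E] [Algebra F E] (κ : F)
    (x : E) (hx : x ^ 2 = algebraMap F E κ) (hadj : Algebra.adjoin F ({x} : Set E) = ⊤) (z : E) :
    ∃ a c : F, z = algebraMap F E a + algebraMap F E c * x := by
  have hz : z ∈ Algebra.adjoin F ({x} : Set E) := by rw [hadj]; trivial
  induction hz using Algebra.adjoin_induction with
  | mem y hy => exact ⟨0, 1, by simpa using hy⟩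
  | algebraMap r => exact ⟨r, 0, by simp⟩
  | add y z _ _ h1 h2 =>
    obtain ⟨a, c, rfl⟩ := h1
    obtain ⟨a', c', rfl⟩ := h2
    exact ⟨a + a', c + c', by simp only [map_add]; ring⟩
  | mul y z _ _ h1 h2 =>
    obtain ⟨a, c, rfl⟩ := h1
    obtain ⟨a', c', rfl⟩ := h2
    refine ⟨a * a' + c * c' * κ, a * c' + c * a', ?_⟩
    simp only [map_add, map_mul]
    linear_combination (algebraMap F E c * algebraMap F E c') * hx

/-- Let `F` be a finite extension of `ℚ₂` and `κ ∈ F*` a nonsquare.  If `E = F(√κ)/F` is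
(totally) ramified, with Galois generator `s` (so `s √κ = -√κ`), then its ramification
break `b`, defined by `v_E (s π_E - π_E) = b + 1` for a uniformizer `π_E`, satisfies
`b = 2 e_F - def_F(κ)`. -/
theorem break_eq_two_e_sub_defect
    (F : Type*) [Field F] [Algebra ℚ_[2] F] [FiniteDimensional ℚ_[2] F]
    (vF : F → WithTop ℤ) (hvF : DiscreteVal F vF)
    (eF : ℤ) (he : vF 2 = (eF : WithTop ℤ))
    (κ : F) (hκ0 : κ ≠ 0) (hκns : ∀ z : F, z ^ 2 ≠ κ)
    (E : Type*) [Field E] [Algebra F E]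
    (x : E) (hx : x ^ 2 = algebraMap F E κ) (hadj : Algebra.adjoin F ({x} : Set E) = ⊤)
    (vE : E → WithTop ℤ) (hvE : DiscreteVal E vE)
    (hram : ∀ a : F, vE (algebraMap F E a) = 2 • vF a)
    (s : E ≃ₐ[F] E) (hs : s x = -x)
    (πE : E) (hπ : vE πE = 1)
    (b d : ℤ) (hd : HasQuadDefect vF κ (d : WithTop ℤ))
    (hb : vE (s πE - πE) = ((b + 1 : ℤ) : WithTop ℤ)) :
    b = 2 * eF - d := by
  obtain ⟨VF, hF, hFm, hFa⟩ := exists_intVal hvF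
  obtain ⟨VE, hE, hEm, hEa⟩ := exists_intVal hvE
  have hinj : ∀ a : F, a ≠ 0 → algebraMap F E a ≠ 0 := fun a ha => by simpa using ha
  have hr : ∀ a : F, a ≠ 0 → VE (algebraMap F E a) = 2 * VF a := by
    intro a ha
    have := hram a
    rw [hE _ (hinj a ha), hF a ha, two_nsmul] at this
    rw [two_mul]
    exact_mod_cast this
  have h2F : (2 : F) ≠ 0 := by
    intro h
    rw [h, hvF.1] at he
    exact WithTop.top_ne_coe he
  have heF : VF 2 = eF := by
    rw [hF _ h2F] at he
    exact_mod_cast he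
  have h2E : (2 : E) ≠ 0 := by
    have := hinj 2 h2F
    rwa [map_ofNat] at this
  have he2 : VE 2 = 2 * eF := by
    have := hr 2 h2F
    rw [heF, map_ofNat] at this
    exact this
  have hx0 : x ≠ 0 := by
    rintro rfl
    apply hinj κ hκ0
    rw [← hx]; simp
  have hVx : VE x = VF κ := by
    have h1 := hr κ hκ0
    rw [← hx, pow_two, hEm x x hx0 hx0] at h1
    omega
  have hπ0 : πE ≠ 0 := by
    rintro rfl
    rw [hvE.1] at hπ
    exact absurd hπ (by decide)
  have hVπ : VE πE = 1 := by
    rw [hE _ hπ0] at hπ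
    exact_mod_cast hπ
  -- values `k² κ - 1` never vanish
  have hns : ∀ k : F, k ^ 2 * κ - 1 ≠ 0 := by
    intro k hk
    have hk0 : k ≠ 0 := by
      rintro rfl
      simp at hk
    apply hκns k⁻¹
    field_simp
    linear_combination -hk
  obtain ⟨⟨k₀, hk₀⟩, hmax⟩ := hd
  have hk₀' : VF (k₀ ^ 2 * κ - 1) = d := by
    rw [hF _ (hns k₀)] at hk₀
    exact_mod_cast hk₀
  have hmax' : ∀ k : F, VF (k ^ 2 * κ - 1) ≤ d := by
    intro k
    have := hmax ⟨k, rfl⟩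
    rw [hF _ (hns k)] at this
    exact_mod_cast this
  obtain ⟨a, c, hac⟩ := exists_coords κ x hx hadj πE
  have hc0 : c ≠ 0 := by
    rintro rfl
    simp only [map_zero, zero_mul, add_zero] at hac
    have ha0 : a ≠ 0 := by
      rintro rfl
      exact hπ0 (by simpa using hac)
    have := hr a ha0
    rw [← hac] at this
    omega
  have hVc : ∀ k : F, k ≠ 0 → VE (algebraMap F E k * x) = 2 * VF k + VF κ := by
    intro k hk
    rw [hEm _ _ (hinj k hk) hx0, hr k hk, hVx]
  have hcx0 : ∀ k : F, k ≠ 0 → algebraMap F E k * x ≠ 0 :=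
    fun k hk => mul_ne_zero (hinj k hk) hx0
  -- the break
  have hbreak : b + 1 = 2 * eF + (2 * VF c + VF κ) := by
    have h1 : s πE - πE = -(2 * (algebraMap F E c * x)) := by
      rw [hac, map_add, map_mul, hs, AlgEquiv.commutes, AlgEquiv.commutes]
      ring
    have h0 : 2 * (algebraMap F E c * x) ≠ 0 := mul_ne_zero h2E (hcx0 c hc0)
    rw [h1, hE _ (neg_ne_zero.2 h0), intVal_neg hEm _ h0, hEm _ _ h2E (hcx0 c hc0), he2,
      hVc c hc0] at hb
    have hb' : 2 * eF + (2 * VF c + VF κ) = b + 1 := by exact_mod_cast hb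
    omega
  suffices hsuff : d = 1 - (2 * VF c + VF κ) by omega
  have hone : VF 1 = 0 := intVal_one hFm
  have honeE : VE 1 = 0 := intVal_one hEm
  rcases Int.even_or_odd' (VF κ) with ⟨r, hκr | hκr⟩
  · -- even valuation
    have ha0 : a ≠ 0 := by
      rintro rfl
      have h1 := hVc c hc0
      have h2 : algebraMap F E c * x = πE := by rw [hac]; simp
      rw [h2] at h1
      omega
    have hva := hr a ha0
    have hvc := hVc c hc0
    have heq : 2 * VF a = 2 * VF c + VF κ := by
      by_contra hne
      have := intVal_add_of_ne hEm hEa _ _ (hinj a ha0) (hcx0 c hc0) (by omega)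
      rw [← hac] at this
      omega
    have hle : VF a ≤ 0 := by
      have := hEa _ _ (hinj a ha0) (hcx0 c hc0) (by rw [← hac]; exact hπ0)
      rw [← hac] at this
      omega
    -- k = -c / a
    obtain ⟨k, hk⟩ : ∃ k : F, k * a = -c := ⟨-c / a, by field_simp⟩
    have hk0 : k ≠ 0 := by
      rintro rfl
      apply hc0
      linear_combination hk
    obtain ⟨w, hw⟩ : ∃ w : E, w = 1 - algebraMap F E k * x := ⟨_, rfl⟩
    have hwa : w * algebraMap F E a = πE := by
      have hk' := congrArg (algebraMap F E) hk
      rw [map_mul, map_neg] at hk'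
      rw [hw, hac]
      linear_combination -x * hk'
    have hw0 : w ≠ 0 := by
      rintro rfl
      exact hπ0 (by rw [← hwa, zero_mul])
    have hVw : VE w = 1 - 2 * VF a := by
      have := hEm _ _ hw0 (hinj a ha0)
      rw [hwa] at this
      omega
    have hfac : ∀ k : F, (1 - algebraMap F E k * x) * -(1 + algebraMap F E k * x)
        = algebraMap F E (k ^ 2 * κ - 1) := by
      intro k
      simp only [map_sub, map_mul, map_pow, map_one]
      linear_combination (algebraMap F E k) ^ 2 * hx
    have hfac0 : ∀ k : F, (1 - algebraMap F E k * x) ≠ 0 ∧ -(1 + algebraMap F E k * x) ≠ 0 := by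
      intro k
      have := hinj _ (hns k)
      rw [← hfac k] at this
      exact ⟨left_ne_zero_of_mul this, right_ne_zero_of_mul this⟩
    have hfacV : ∀ k : F, VE (1 - algebraMap F E k * x) + VE (1 + algebraMap F E k * x)
        = 2 * VF (k ^ 2 * κ - 1) := by
      intro k
      have h1 := hEm _ _ (hfac0 k).1 (hfac0 k).2
      rw [hfac k, hr _ (hns k), intVal_neg hEm _ (neg_ne_zero.1 (hfac0 k).2)] at h1
      omega
    -- lower bound
    have hw2 : 1 + algebraMap F E k * x = 2 + -w := by rw [hw]; ring
    have hVne : VE 2 ≠ VE (-w) := by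
      rw [intVal_neg hEm _ hw0]
      omega
    have hVw2 := intVal_add_of_ne hEm hEa 2 (-w) h2E (neg_ne_zero.2 hw0) hVne
    have hfk := hfacV k
    rw [hw2, hVw2, ← hw, intVal_neg hEm _ hw0] at hfk
    have hlow : VF (k ^ 2 * κ - 1) = 1 - 2 * VF a := by omega
    have hge : 1 - 2 * VF a ≤ d := hlow ▸ hmax' k
    -- upper bound
    have hno : ∀ k' : F, VE (1 - algebraMap F E k' * x) ≤ 1 - 2 * VF a := by
      intro k'
      by_contra! hlt
      have h1 := intVal_add_of_lt hEm hEa w (-(1 - algebraMap F E k' * x)) hw0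
        (neg_ne_zero.2 (hfac0 k').1) (by rw [intVal_neg hEm _ (hfac0 k').1]; omega)
      have h2 : w + -(1 - algebraMap F E k' * x) = algebraMap F E (k' - k) * x := by
        rw [hw, map_sub]; ring
      rw [h2] at h1
      by_cases hkk : k' - k = 0
      · rw [sub_eq_zero.1 hkk, ← hw] at hlt
        omega
      · rw [hVc _ hkk] at h1
        omega
    have hle2 : d ≤ 1 - 2 * VF a := by
      have h1 := hfacV k₀
      have h2 := hno k₀
      have h3 := hno (-k₀)
      rw [map_neg, neg_mul, sub_neg_eq_add] at h3
      omega
    omega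
  · -- odd valuation
    have hsum : 2 * VF c + VF κ = 1 := by
      by_cases ha0 : a = 0
      · have h1 := hVc c hc0
        have h2 : algebraMap F E c * x = πE := by rw [hac, ha0]; simp
        rw [h2] at h1
        omega
      · have h1 := hVc c hc0
        have h2 := hr a ha0
        have := intVal_add_of_ne hEm hEa _ _ (hinj a ha0) (hcx0 c hc0) (by omega)
        rw [← hac] at this
        omega
    have hd0 : 0 ≤ d := by
      have := hmax' 0
      have h0 : ((0 : F) ^ 2 * κ - 1) = -1 := by ring
      rw [h0, intVal_neg hFm 1 one_ne_zero] at this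
      omega
    have hd1 : d ≤ 0 := by
      by_cases hk : k₀ = 0
      · have h0 : (k₀ ^ 2 * κ - 1) = -1 := by rw [hk]; ring
        rw [h0, intVal_neg hFm 1 one_ne_zero] at hk₀'
        omega
      · have h1 : VF (k₀ ^ 2 * κ) = 2 * VF k₀ + VF κ := by
          rw [hFm _ _ (pow_ne_zero 2 hk) hκ0, pow_two, hFm _ _ hk hk]
          ring
        have hn1 : VF (-1) = 0 := by rw [intVal_neg hFm 1 one_ne_zero, hone]
        have := intVal_add_of_ne hFm hFa (k₀ ^ 2 * κ) (-1)
          (mul_ne_zero (pow_ne_zero 2 hk) hκ0) (by simp) (by omega)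
        rw [← sub_eq_add_neg] at this
        omega
    omega
end

section
/- Let E/F be a ramified quadratic extension of 2-adic fields with odd break number b, and let κ ∈ F* \ (E*)². Then def_E(κ) ≥ min{2·def_F(κ) + b, def_F(κ) + 2e_F}, with equality whenever def_F(κ) ≠ 2e_F − b. -/
namespace DG
section basic
variable {K : Type*} [Field K] {v : K → WithTop ℤ}

lemma vex (h : DiscreteVal K v) {x : K} (hx : x ≠ 0) : ∃ n : ℤ, v x = (n : WithTop ℤ) := by
  have : v x ≠ ⊤ := fun h' => hx (h.2.1 x h')
  obtain ⟨n, hn⟩ := WithTop.ne_top_iff_exists.1 this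
  exact ⟨n, hn.symm⟩

lemma vne (h : DiscreteVal K v) {x : K} {n : ℤ} (hx : v x = (n : WithTop ℤ)) : x ≠ 0 := by
  rintro rfl
  rw [h.1] at hx
  exact WithTop.top_ne_coe hx

lemma vmul (h : DiscreteVal K v) {x y : K} {n m : ℤ} (hx : v x = (n : WithTop ℤ))
    (hy : v y = (m : WithTop ℤ)) : v (x * y) = ((n + m : ℤ) : WithTop ℤ) := by
  rw [h.2.2.1, hx, hy, WithTop.coe_add]

lemma vmul_ge (h : DiscreteVal K v) {x y : K} {n m : ℤ} (hx : (n : WithTop ℤ) ≤ v x)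
    (hy : (m : WithTop ℤ) ≤ v y) : ((n + m : ℤ) : WithTop ℤ) ≤ v (x * y) := by
  rw [h.2.2.1, WithTop.coe_add]
  exact add_le_add hx hy

lemma vone (h : DiscreteVal K v) : v 1 = ((0 : ℤ) : WithTop ℤ) := by
  obtain ⟨n, hn⟩ := vex h (one_ne_zero (α := K))
  have h1 := vmul h hn hn
  rw [mul_one, hn] at h1
  have : n = n + n := by exact_mod_cast h1
  rw [hn]; congr 1; omega

lemma vneg (h : DiscreteVal K v) (x : K) : v (-x) = v x := by
  have hm : v (-1) = ((0 : ℤ) : WithTop ℤ) := by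
    obtain ⟨n, hn⟩ := vex h (neg_ne_zero.2 (one_ne_zero (α := K)))
    have h1 := vmul h hn hn
    rw [neg_one_mul, neg_neg, vone h] at h1
    have : 0 = n + n := by exact_mod_cast h1
    rw [hn]; congr 1; omega
  rw [← neg_one_mul, h.2.2.1, hm]
  simp

lemma vadd_ge (h : DiscreteVal K v) {x y : K} {n : WithTop ℤ} (hx : n ≤ v x)
    (hy : n ≤ v y) : n ≤ v (x + y) := (le_min hx hy).trans (h.2.2.2.1 x y)

lemma vsub_ge (h : DiscreteVal K v) {x y : K} {n : WithTop ℤ} (hx : n ≤ v x)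
    (hy : n ≤ v y) : n ≤ v (x - y) := by
  rw [sub_eq_add_neg]; exact vadd_ge h hx (by rwa [vneg h])

lemma vadd_gt (h : DiscreteVal K v) {x y : K} {n : WithTop ℤ} (hx : n < v x)
    (hy : n < v y) : n < v (x + y) := (lt_min hx hy).trans_le (h.2.2.2.1 x y)

lemma vsub_gt (h : DiscreteVal K v) {x y : K} {n : WithTop ℤ} (hx : n < v x)
    (hy : n < v y) : n < v (x - y) := by
  rw [sub_eq_add_neg]; exact vadd_gt h hx (by rwa [vneg h])

lemma vadd_eq (h : DiscreteVal K v) {x y : K} {n : WithTop ℤ} (hx : v x = n)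
    (hy : n < v y) : v (x + y) = n := by
  apply le_antisymm _ (vadd_ge h hx.ge hy.le)
  by_contra hc
  push Not at hc
  have := vsub_gt h hc hy
  rw [add_sub_cancel_right, hx] at this
  exact lt_irrefl _ this

lemma vsub_eq (h : DiscreteVal K v) {x y : K} {n : WithTop ℤ} (hx : v x = n)
    (hy : n < v y) : v (x - y) = n := by
  rw [sub_eq_add_neg]; exact vadd_eq h hx (by rwa [vneg h])

lemma vinv (h : DiscreteVal K v) {x : K} {n : ℤ} (hx : v x = (n : WithTop ℤ)) :
    v x⁻¹ = ((-n : ℤ) : WithTop ℤ) := by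
  have h0 := vne h hx
  obtain ⟨m, hm⟩ := vex h (inv_ne_zero h0)
  have h1 := vmul h hx hm
  rw [mul_inv_cancel₀ h0, vone h] at h1
  have : 0 = n + m := by exact_mod_cast h1
  rw [hm]; congr 1; omega

lemma vdiv (h : DiscreteVal K v) {x y : K} {n m : ℤ} (hx : v x = (n : WithTop ℤ))
    (hy : v y = (m : WithTop ℤ)) : v (x / y) = ((n - m : ℤ) : WithTop ℤ) := by
  rw [div_eq_mul_inv, sub_eq_add_neg]; exact vmul h hx (vinv h hy)

lemma vpow (h : DiscreteVal K v) {x : K} {n : ℤ} (hx : v x = (n : WithTop ℤ)) (k : ℕ) :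
    v (x ^ k) = ((k * n : ℤ) : WithTop ℤ) := by
  induction k with
  | zero => simpa using vone h
  | succ k ih => rw [pow_succ, vmul h ih hx]; congr 1; push_cast; ring

lemma vzpow (h : DiscreteVal K v) {x : K} {n : ℤ} (hx : v x = (n : WithTop ℤ)) (k : ℤ) :
    v (x ^ k) = ((k * n : ℤ) : WithTop ℤ) := by
  cases k with
  | ofNat k => simpa using vpow h hx k
  | negSucc k =>
    rw [zpow_negSucc, vinv h (vpow h hx (k+1))]; congr 1; push_cast; grind

lemma odd_defect (h : DiscreteVal K v) {e : ℤ} (he : v 2 = (e : WithTop ℤ)) {κ : K} {d n : ℤ}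
    (hd : HasQuadDefect v κ (d : WithTop ℤ)) (k : K)
    (hk : v (k ^ 2 * κ - 1) = (n : WithTop ℤ)) (hn : Odd n) (h0 : 0 < n) (h1 : n < 2 * e) :
    d = n := by
  have hle : (n : WithTop ℤ) ≤ d := hd.2 ⟨k, hk⟩
  have hle' : n ≤ d := by exact_mod_cast hle
  rcases eq_or_lt_of_le hle' with hh | hlt
  · exact hh.symm
  exfalso
  obtain ⟨l, hl⟩ := hd.1
  have hB : v (l ^ 2 * κ) = ((0:ℤ) : WithTop ℤ) := by
    have := vadd_eq h (y := l ^ 2 * κ - 1) (vone h) (by rw [hl]; exact_mod_cast h0.trans hlt)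
    rwa [add_sub_cancel] at this
  have hB0 := vne h hB
  have hl0 : l ≠ 0 := by rintro rfl; simp at hB0
  have hdiff : v (((k / l) ^ 2 - 1) * (l ^ 2 * κ)) = (n : WithTop ℤ) := by
    have := vsub_eq h (y := l ^ 2 * κ - 1) hk (by rw [hl]; exact_mod_cast hlt)
    rw [← this]; congr 1; field_simp; ring
  have hne := vne h hdiff
  have h3 : v ((k / l) ^ 2 - 1) = (n : WithTop ℤ) := by
    have := vdiv h hdiff hB
    rwa [mul_div_cancel_right₀ _ hB0, sub_zero] at this
  set r := k / l - 1 with hr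
  have h4 : (k / l) ^ 2 - 1 = r * (r + 2) := by rw [hr]; ring
  rw [h4] at h3
  have h5 := vne h h3
  obtain ⟨j, hj⟩ := vex h (left_ne_zero_of_mul h5)
  rcases lt_or_ge j e with hje | hje
  · have h6 : v (r + 2) = j := vadd_eq h hj (by rw [he]; exact_mod_cast hje)
    have h7 := vmul h hj h6
    rw [h3] at h7
    have : n = j + j := by exact_mod_cast h7
    rw [this] at hn
    exact (Int.not_even_iff_odd.2 hn) ⟨j, rfl⟩
  · have h8 : (e : WithTop ℤ) ≤ v r := by rw [hj]; exact_mod_cast hje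
    have h6 : (e : WithTop ℤ) ≤ v (r + 2) := vadd_ge h h8 he.ge
    have h7 := vmul_ge h h8 h6
    rw [h3] at h7
    have : e + e ≤ n := by exact_mod_cast h7
    omega
end basic

section top
variable {K : Type*} [Field K] [Algebra ℚ_[2] K] {v : K → WithTop ℤ}

lemma cube (u : ℤ_[2]) (hu : IsUnit u) : ∃ w : ℤ_[2], IsUnit w ∧ w ^ 3 = u := by
  have h1 : ‖(1 - u : ℤ_[2])‖ < 1 := by
    have hz : PadicInt.toZMod (p := 2) (1 - u) = 0 := by
      have : IsUnit (PadicInt.toZMod (p := 2) u) := hu.map _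
      have h2 : ∀ z : ZMod 2, IsUnit z → 1 - z = 0 := by decide
      simpa using h2 _ this
    have : (1 - u) ∈ IsLocalRing.maximalIdeal ℤ_[2] := by
      rw [← PadicInt.ker_toZMod]; exact hz
    have := (IsLocalRing.mem_maximalIdeal _).1 this
    exact PadicInt.mem_nonunits.1 this
  have h3 : ‖(3 : ℤ_[2])‖ = 1 := by
    have := PadicInt.norm_natCast_eq_one_iff (p := 2) (n := 3)
    exact_mod_cast this.2 (by norm_num)
  obtain ⟨z, hz, -⟩ := hensels_lemma (p := 2) (R := ℤ_[2])
    (F := (Polynomial.X ^ 3 - Polynomial.C u)) (a := 1) (by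
      have h3' : ‖(2 + 1 : ℤ_[2])‖ = 1 := by rw [← h3]; norm_num
      simp [h3']
      simpa using h1)
  have hz' : z ^ 3 = u := by
    simpa [sub_eq_zero] using hz
  refine ⟨z, ?_, hz'⟩
  rw [← hz'] at hu
  exact (isUnit_pow_iff (by norm_num)).1 hu

lemma vunit (h : DiscreteVal K v) (u : ℤ_[2]) (hu : IsUnit u) :
    v (algebraMap ℚ_[2] K (u : ℚ_[2])) = ((0 : ℤ) : WithTop ℤ) := by
  have key : ∀ n : ℕ, ∀ u : ℤ_[2], IsUnit u → ∃ m : ℤ,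
      v (algebraMap ℚ_[2] K (u : ℚ_[2])) = ((3 ^ n * m : ℤ) : WithTop ℤ) := by
    intro n
    induction n with
    | zero =>
      intro u hu
      have : algebraMap ℚ_[2] K (u : ℚ_[2]) ≠ 0 := by
        simpa using hu.ne_zero
      simpa using vex h this
    | succ n ih =>
      intro u hu
      obtain ⟨w, hw, rfl⟩ := cube u hu
      obtain ⟨m, hm⟩ := ih w hw
      refine ⟨m, ?_⟩
      have := vpow h hm 3
      rw [show ((w ^ 3 : ℤ_[2]) : ℚ_[2]) = (w : ℚ_[2]) ^ 3 from PadicInt.coe_pow w 3, map_pow, this]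
      congr 1
      push_cast
      ring
  obtain ⟨m, hm⟩ := key 0 u hu
  simp only [pow_zero, one_mul] at hm
  rw [hm]
  congr 1
  by_contra hm0
  obtain ⟨m', hm'⟩ := key m.natAbs u hu
  rw [hm] at hm'
  have h1 : m = 3 ^ m.natAbs * m' := by exact_mod_cast hm'
  have h2 : 3 ^ m.natAbs ∣ m.natAbs := by
    rw [← Int.natCast_dvd_natCast]
    push_cast
    rw [dvd_abs]
    exact ⟨m', h1⟩
  have h3 := Nat.le_of_dvd (Int.natAbs_pos.2 hm0) h2
  exact absurd (Nat.lt_pow_self (n := m.natAbs) (by norm_num : 1 < 3)) (by omega)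

lemma vpadic (h : DiscreteVal K v) {e : ℤ} (he : v 2 = (e : WithTop ℤ)) (x : ℚ_[2]) (hx : x ≠ 0) :
    v (algebraMap ℚ_[2] K x) = ((x.valuation * e : ℤ) : WithTop ℤ) := by
  have h2 : (2 : ℚ_[2]) ≠ 0 := by norm_num
  have hn : ‖x * (2 : ℚ_[2]) ^ (-x.valuation)‖ = 1 := by
    rw [norm_mul, norm_zpow, Padic.norm_eq_zpow_neg_valuation hx]
    have : ‖(2 : ℚ_[2])‖ = 2⁻¹ := by simpa using Padic.norm_p (p := 2)
    rw [this]
    simp only [Nat.cast_ofNat, zpow_neg, inv_zpow, inv_inv]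
    exact inv_mul_cancel₀ (by positivity)
  let u : ℤ_[2] := ⟨x * (2 : ℚ_[2]) ^ (-x.valuation), hn.le⟩
  have hu : IsUnit u := PadicInt.isUnit_iff.2 hn
  have h1 := vunit h u hu
  have h3 := vmul h h1 (vzpow h he x.valuation)
  rw [zero_add] at h3
  rw [← h3]
  congr 1
  have : (2 : K) = algebraMap ℚ_[2] K 2 := (map_ofNat _ 2).symm
  rw [this, ← map_zpow₀, ← map_mul]
  congr 1
  simp only [u]
  rw [mul_assoc, ← zpow_add₀ h2]
  simp

noncomputable def g (ρ : ℝ) : WithTop ℤ → ℝ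
  | none => 0
  | some n => ρ ^ n

lemma g_coe (ρ : ℝ) (n : ℤ) : g ρ (n : WithTop ℤ) = ρ ^ n := rfl
lemma g_top (ρ : ℝ) : g ρ ⊤ = 0 := rfl

lemma g_nonneg {ρ : ℝ} (h0 : 0 < ρ) (x : WithTop ℤ) : 0 ≤ g ρ x := by
  induction x using WithTop.recTopCoe with
  | top => rw [g_top]
  | coe n => rw [g_coe]; positivity

lemma g_anti {ρ : ℝ} (h0 : 0 < ρ) (h1 : ρ < 1) {x y : WithTop ℤ} (hxy : x ≤ y) :
    g ρ y ≤ g ρ x := by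
  induction y using WithTop.recTopCoe with
  | top => exact g_nonneg h0 x
  | coe m =>
    induction x using WithTop.recTopCoe with
    | top => simp at hxy
    | coe n =>
      rw [g_coe, g_coe]
      exact zpow_le_zpow_right_of_le_one₀ h0 h1.le (by exact_mod_cast hxy)

lemma g_strict {ρ : ℝ} (h0 : 0 < ρ) (h1 : ρ < 1) {x y : WithTop ℤ} (hxy : g ρ y < g ρ x) :
    x < y := by
  by_contra hc
  push Not at hc
  exact absurd (g_anti h0 h1 hc) (not_le.2 hxy)

lemma g_add {ρ : ℝ} (h0 : 0 < ρ) (x y : WithTop ℤ) : g ρ (x + y) = g ρ x * g ρ y := by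
  induction x using WithTop.recTopCoe with
  | top => simp [g_top]
  | coe n =>
    induction y using WithTop.recTopCoe with
    | top => simp [g_top]
    | coe m => rw [← WithTop.coe_add, g_coe, g_coe, g_coe, zpow_add₀ h0.ne']

noncomputable def absv (h : DiscreteVal K v) (ρ : ℝ) (h0 : 0 < ρ) (h1 : ρ < 1) :
    AbsoluteValue K ℝ where
  toFun x := g ρ (v x)
  map_mul' x y := by rw [h.2.2.1, g_add h0]
  nonneg' x := g_nonneg h0 _
  eq_zero' x := by
    constructor
    · intro hx
      by_contra hc
      obtain ⟨n, hn⟩ := vex h hc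
      rw [hn, g_coe] at hx
      exact (zpow_pos h0 n).ne' hx
    · rintro rfl
      rw [h.1, g_top]
  add_le' x y := by
    have h2 := h.2.2.2.1 x y
    have h3 := g_anti h0 h1 h2
    rcases min_choice (v x) (v y) with h4 | h4 <;> rw [h4] at h3
    · linarith [g_nonneg h0 (v y)]
    · linarith [g_nonneg h0 (v x)]

/-- existence of a proper norm for the valuation -/
lemma exists_norm [FiniteDimensional ℚ_[2] K] (h : DiscreteVal K v) {e : ℤ}
    (he : v 2 = (e : WithTop ℤ)) (hpos : 0 < e) :
    ∃ (ρ : ℝ) (h0 : 0 < ρ) (h1 : ρ < 1),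
      @ProperSpace K (absv h ρ h0 h1).toNormedField.toPseudoMetricSpace := by
  have heR : (0 : ℝ) < e := by exact_mod_cast hpos
  set ρ : ℝ := (2 : ℝ) ^ (-(1 / e : ℝ)) with hρ
  have h0 : 0 < ρ := by positivity
  have h1 : ρ < 1 := Real.rpow_lt_one_of_one_lt_of_neg (by norm_num) (by simpa using heR)
  have h2 : ρ ^ e = 2⁻¹ := by
    rw [hρ, ← Real.rpow_intCast, ← Real.rpow_mul (by norm_num)]
    rw [show -(1 / (e:ℝ)) * e = -1 by field_simp, Real.rpow_neg_one]
  let f := absv h ρ h0 h1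
  let N : NormedField K := f.toNormedField
  refine ⟨ρ, h0, h1, ?_⟩
  let S : NormedSpace ℚ_[2] K :=
    { (inferInstance : Module ℚ_[2] K) with
      norm_smul_le := by
        intro a x
        rw [Algebra.smul_def, norm_mul]
        apply le_of_eq
        congr 1
        change g ρ (v _) = _
        by_cases ha : a = 0
        · subst ha; simp [h.1, g_top]
        · rw [vpadic h he a ha, g_coe, Padic.norm_eq_zpow_neg_valuation ha, mul_comm, zpow_mul, h2]
          simp }
  exact FiniteDimensional.proper ℚ_[2] K

lemma perfect [FiniteDimensional ℚ_[2] K] (h : DiscreteVal K v) {e : ℤ}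
    (he : v 2 = (e : WithTop ℤ)) (hpos : 0 < e) {a : K} (ha : v a = ((0 : ℤ) : WithTop ℤ)) :
    ∃ t : K, ((0 : ℤ) : WithTop ℤ) < v (t ^ 2 - a) := by
  obtain ⟨ρ, h0, h1, hP⟩ := exists_norm h he hpos
  let N : NormedField K := (absv h ρ h0 h1).toNormedField
  have hnorm : ∀ x : K, ‖x‖ = g ρ (v x) := fun x => rfl
  have : ProperSpace K := hP
  have hc : IsCompact (Metric.closedBall (0 : K) 1) := isCompact_closedBall _ _
  have hv : ∀ n : ℕ, v (a ^ 2 ^ n) = ((0 : ℤ) : WithTop ℤ) := by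
    intro n
    rw [vpow h ha]; simp
  obtain ⟨L, -, φ, hφ, hL⟩ := hc.tendsto_subseq (x := fun n : ℕ => a ^ 2 ^ n) (by
    intro n
    rw [mem_closedBall_zero_iff, hnorm, hv n, g_coe, zpow_zero])
  have hC := hL.cauchySeq
  obtain ⟨M, hM⟩ := Metric.cauchySeq_iff'.1 hC 1 one_pos
  have h3 := hM (M + 1) (Nat.le_succ M)
  have h4 : φ M < φ (M + 1) := hφ (Nat.lt_succ_self M)
  obtain ⟨j, hj⟩ : ∃ j, φ (M + 1) = φ M + j + 1 := ⟨φ (M + 1) - φ M - 1, by omega⟩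
  have h5 : ((0 : ℤ) : WithTop ℤ) < v (a ^ 2 ^ (φ M + j + 1) - a ^ 2 ^ (φ M)) := by
    apply g_strict h0 h1
    rw [g_coe, zpow_zero, ← hj, ← hnorm, ← dist_eq_norm]
    exact h3
  have key : ∀ i : ℕ, ((0 : ℤ) : WithTop ℤ) < v (a ^ 2 ^ (i + j + 1) - a ^ 2 ^ i) →
      ((0 : ℤ) : WithTop ℤ) < v (a ^ 2 ^ (j + 1) - a ^ 2 ^ 0) := by
    intro i
    induction i with
    | zero => intro h; simpa using h
    | succ i ih =>
      intro hi
      apply ih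
      set x := a ^ 2 ^ (i + j + 1) with hx
      set y := a ^ 2 ^ i with hy
      have e1 : a ^ 2 ^ (i + 1 + j + 1) = x ^ 2 := by
        rw [hx, ← pow_mul, ← pow_succ]; ring_nf
      have e2 : a ^ 2 ^ (i + 1) = y ^ 2 := by
        rw [hy, ← pow_mul, ← pow_succ]
      have hvx : v x = ((0 : ℤ) : WithTop ℤ) := hv _
      have hvy : v y = ((0 : ℤ) : WithTop ℤ) := hv _
      have h2y : ((0 : ℤ) : WithTop ℤ) < v (2 * y) := by
        rw [vmul h he hvy, add_zero]; exact_mod_cast hpos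
      rw [e1, e2] at hi
      by_contra hcon
      push Not at hcon
      have hge : ((0 : ℤ) : WithTop ℤ) ≤ v (x - y) := vsub_ge h hvx.ge hvy.ge
      have hz := le_antisymm hcon hge
      have hz2 : v (x - y + 2 * y) = ((0 : ℤ) : WithTop ℤ) := vadd_eq h hz h2y
      have hz3 := vmul h hz hz2
      rw [show (x - y) * (x - y + 2 * y) = x ^ 2 - y ^ 2 by ring] at hz3
      rw [hz3] at hi
      simp at hi
  have h6 := key _ h5
  refine ⟨a ^ 2 ^ j, ?_⟩
  rw [← pow_mul, ← pow_succ]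
  simpa using h6

lemma hensel [FiniteDimensional ℚ_[2] K] (h : DiscreteVal K v) {e : ℤ}
    (he : v 2 = (e : WithTop ℤ)) (hpos : 0 < e) {x : K}
    (hx : ((2 * e : ℤ) : WithTop ℤ) < v (x - 1)) : ∃ y : K, y ^ 2 = x := by
  obtain ⟨ρ, h0, h1, hP⟩ := exists_norm h he hpos
  let N : NormedField K := (absv h ρ h0 h1).toNormedField
  have hnorm : ∀ x : K, ‖x‖ = g ρ (v x) := fun x => rfl
  have : ProperSpace K := hP
  have h20 : (2 : K) ≠ 0 := vne h he
  have h4 : v (4 : K) = ((2 * e : ℤ) : WithTop ℤ) := by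
    rw [show (4 : K) = 2 * 2 by norm_num, vmul h he he]; congr 1; ring
  set c := (x - 1) / 4 with hcdef
  have h40 := vne h h4
  have hxc : x = 1 + 4 * c := by rw [hcdef]; field_simp; ring
  have hc : ((1 : ℤ) : WithTop ℤ) ≤ v c := by
    by_cases hc0 : c = 0
    · rw [hc0, h.1]; exact le_top
    obtain ⟨n, hn⟩ := vex h hc0
    have := vmul h h4 hn
    rw [show 4 * c = x - 1 by rw [hxc]; ring] at this
    rw [this] at hx
    have : 2 * e < 2 * e + n := by exact_mod_cast hx
    rw [hn]
    have : 1 ≤ n := by omega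
    exact_mod_cast this
  have hmem : ∀ y : K, y ∈ Metric.closedBall (0 : K) ρ ↔ ((1 : ℤ) : WithTop ℤ) ≤ v y := by
    intro y
    rw [mem_closedBall_zero_iff, hnorm]
    constructor
    · intro hy
      by_contra hcon
      push Not at hcon
      have hy0 : y ≠ 0 := by rintro rfl; rw [h.1] at hcon; simp at hcon
      obtain ⟨n, hn⟩ := vex h hy0
      rw [hn] at hcon hy
      have hn1 : n < 1 := by exact_mod_cast hcon
      rw [g_coe] at hy
      have : ρ ^ (0 : ℤ) ≤ ρ ^ n := zpow_le_zpow_right_of_le_one₀ h0 h1.le (by omega)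
      rw [zpow_zero] at this
      linarith
    · intro hy
      have := g_anti h0 h1 hy
      rwa [g_coe, zpow_one] at this
  let f : K → K := fun y => c - y ^ 2
  have hmaps : Set.MapsTo f (Metric.closedBall (0 : K) ρ) (Metric.closedBall (0 : K) ρ) := by
    intro y hy
    rw [hmem] at hy ⊢
    apply vsub_ge h hc
    rw [pow_two]
    refine le_trans ?_ (vmul_ge h hy hy)
    norm_cast
  have hcomp : IsComplete (Metric.closedBall (0 : K) ρ) := Metric.isClosed_closedBall.isComplete
  have hcontr : ContractingWith ⟨ρ, h0.le⟩ (hmaps.restrict f _ _) := by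
    refine ⟨by exact_mod_cast h1, LipschitzWith.of_dist_le_mul ?_⟩
    rintro ⟨y, hy⟩ ⟨z, hz⟩
    rw [Subtype.dist_eq, Subtype.dist_eq]
    simp only [Set.MapsTo.val_restrict_apply, f]
    rw [dist_eq_norm, dist_eq_norm, show c - y ^ 2 - (c - z ^ 2) = -((y + z) * (y - z)) by ring,
      norm_neg, norm_mul]
    apply mul_le_mul_of_nonneg_right _ (norm_nonneg _)
    have : y + z ∈ Metric.closedBall (0 : K) ρ := by
      rw [hmem] at hy hz ⊢
      exact vadd_ge h hy hz
    rw [mem_closedBall_zero_iff] at this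
    exact this
  obtain ⟨y, -, hfix, -⟩ := hcontr.exists_fixedPoint' hcomp hmaps (x := 0)
    (by simp [h0.le]) (edist_ne_top _ _)
  refine ⟨1 + 2 * y, ?_⟩
  have hy : c - y ^ 2 = y := hfix
  rw [hxc]
  linear_combination (-4) * hy
end top

section ext
variable {F : Type*} [Field F] {E : Type*} [Field E] [Algebra F E]
  {v : F → WithTop ℤ} {w : E → WithTop ℤ}

lemma w_of_v (hram : ∀ a : F, w (algebraMap F E a) = 2 • v a) {a : F} {n : ℤ}
    (ha : v a = (n : WithTop ℤ)) : w (algebraMap F E a) = ((2 * n : ℤ) : WithTop ℤ) := by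
  rw [hram, ha, two_nsmul, ← WithTop.coe_add]; congr 1; ring

lemma even_w (hv : DiscreteVal F v) (hw : DiscreteVal E w)
    (hram : ∀ a : F, w (algebraMap F E a) = 2 • v a) {a : F} {n : ℤ}
    (ha : w (algebraMap F E a) = (n : WithTop ℤ)) : ∃ m : ℤ, v a = (m : WithTop ℤ) ∧ n = 2 * m := by
  have h0 : a ≠ 0 := by rintro rfl; exact vne hw ha (map_zero _)
  obtain ⟨m, hm⟩ := vex hv h0
  refine ⟨m, hm, ?_⟩
  have := w_of_v hram hm
  rw [ha] at this
  exact_mod_cast this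

lemma gt_of_w (hv : DiscreteVal F v) (hram : ∀ a : F, w (algebraMap F E a) = 2 • v a) {a : F} {n : ℤ}
    (ha : (n : WithTop ℤ) < v a) : ((2 * n + 2 : ℤ) : WithTop ℤ) ≤ w (algebraMap F E a) := by
  by_cases h0 : a = 0
  · rw [hram, h0, hv.1, two_nsmul]; simp
  obtain ⟨m, hm⟩ := vex hv h0
  rw [w_of_v hram hm]
  rw [hm] at ha
  have : n < m := by exact_mod_cast ha
  have : 2 * n + 2 ≤ 2 * m := by omega
  exact_mod_cast this

lemma structure_lemma (hv : DiscreteVal F v) (hw : DiscreteVal E w)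
    (hram : ∀ a : F, w (algebraMap F E a) = 2 • v a)
    {e : ℤ} (he : v 2 = (e : WithTop ℤ)) (hquad : Module.finrank F E = 2)
    (s : E ≃ₐ[F] E) (π : E) (hπ : w π = ((1 : ℤ) : WithTop ℤ))
    (b : ℤ) (hbodd : Odd b) (hb : w (s π - π) = ((b + 1 : ℤ) : WithTop ℤ)) :
    1 ≤ b ∧ b < 2 * e ∧ w (s π) = ((1 : ℤ) : WithTop ℤ) ∧
    (∀ z : E, ∃ p q : F, z = algebraMap F E p + algebraMap F E q * π) ∧
    (∀ z : E, ∃ ν : F, algebraMap F E ν = z * s z) := by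
  have hπ0 := vne hw hπ
  have hli : LinearIndependent F ![(1 : E), π] := by
    rw [LinearIndependent.pair_iff]
    intro x y hxy
    have hy : y = 0 := by
      by_contra hy
      have h1 : algebraMap F E (-x / y) = π := by
        have hy' : algebraMap F E y ≠ 0 := by simpa using hy
        rw [Algebra.smul_def, Algebra.smul_def] at hxy
        rw [map_div₀, map_neg]
        field_simp
        linear_combination -hxy
      rw [← h1] at hπ
      obtain ⟨m, -, hm⟩ := even_w hv hw hram hπ
      omega
    subst hy
    refine ⟨?_, rfl⟩
    simpa using hxy
  have : FiniteDimensional F E := FiniteDimensional.of_finrank_pos (by omega)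
  have hspan := hli.span_eq_top_of_card_eq_finrank' (by simp [hquad])
  have hrep : ∀ z : E, ∃ p q : F, z = algebraMap F E p + algebraMap F E q * π := by
    intro z
    have hz : z ∈ Submodule.span F (Set.range ![(1 : E), π]) := by rw [hspan]; trivial
    rw [Matrix.range_cons, Matrix.range_cons, Matrix.range_empty, Set.union_empty,
      Set.singleton_union, Submodule.mem_span_pair] at hz
    obtain ⟨p, q, hpq⟩ := hz
    refine ⟨p, q, ?_⟩
    rw [← hpq, Algebra.smul_def, Algebra.smul_def, mul_one]
  obtain ⟨M, T, hMT⟩ := hrep (π ^ 2)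
  have hsMT : s π ^ 2 = algebraMap F E M + algebraMap F E T * s π := by
    have := congrArg s hMT
    simpa using this
  have hne : s π - π ≠ 0 := vne hw hb
  have hsπ : s π = algebraMap F E T - π := by
    have : (s π - π) * (s π + π - algebraMap F E T) = 0 := by
      linear_combination hsMT - hMT
    rcases mul_eq_zero.1 this with h | h
    · exact absurd h hne
    · linear_combination h
  have hM0 : M ≠ 0 := by
    rintro rfl
    have : π = algebraMap F E T := by
      apply mul_right_cancel₀ hπ0
      rw [← pow_two, hMT]; simp
    rw [this] at hπ
    obtain ⟨m, -, hm⟩ := even_w hv hw hram hπ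
    omega
  obtain ⟨M', hM'⟩ := vex hv hM0
  have hwM := w_of_v hram hM'
  have hw2 : w 2 = ((2 * e : ℤ) : WithTop ℤ) := by
    rw [← w_of_v hram he]; congr 1; exact (map_ofNat _ 2).symm
  have hw2π := vmul hw hw2 hπ
  have hTb : s π - π = algebraMap F E T - 2 * π := by rw [hsπ]; ring
  obtain ⟨c, hc⟩ := hbodd
  have hwT : w (algebraMap F E T) = ((b + 1 : ℤ) : WithTop ℤ) ∧ b < 2 * e := by
    by_cases hT0 : T = 0
    · rw [hTb, hT0, map_zero, zero_sub, vneg hw, hw2π] at hb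
      have : 2 * e + 1 = b + 1 := by exact_mod_cast hb
      omega
    obtain ⟨t, ht⟩ := vex hv hT0
    have hwt := w_of_v hram ht
    rw [hTb] at hb
    rcases lt_trichotomy (2 * t) (2 * e + 1) with hlt | heq | hgt
    · have := vsub_eq hw hwt (y := 2 * π) (by rw [hw2π]; exact_mod_cast hlt)
      rw [hb] at this
      have h' : b + 1 = 2 * t := by exact_mod_cast this
      rw [hwt, h']
      exact ⟨rfl, by omega⟩
    · omega
    · have := vsub_eq hw hw2π (y := algebraMap F E T) (by rw [hwt]; exact_mod_cast hgt)
      rw [← vneg hw, neg_sub, hb] at this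
      have h' : b + 1 = 2 * e + 1 := by exact_mod_cast this
      omega
  have hb1 : 1 ≤ b := by
    by_contra hcon
    have h1 := vmul hw hwT.1 hπ
    have h2 := vpow hw hπ 2
    have h3 := vsub_eq hw h1 (y := π ^ 2) (by
      rw [h2]
      have : b + 1 + 1 < ((2 : ℕ) : ℤ) * 1 := by push_cast; omega
      exact_mod_cast this)
    rw [hMT, sub_add_cancel_right, vneg hw, hwM] at h3
    have : 2 * M' = b + 1 + 1 := by exact_mod_cast h3
    omega
  refine ⟨hb1, hwT.2, ?_, hrep, ?_⟩
  · rw [hsπ, ← vneg hw, neg_sub]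
    apply vsub_eq hw hπ
    rw [hwT.1]
    have : 1 < b + 1 := by omega
    exact_mod_cast this
  · intro z
    obtain ⟨p, q, rfl⟩ := hrep z
    refine ⟨p ^ 2 + p * q * T - q ^ 2 * M, ?_⟩
    simp only [map_add, map_mul, map_sub, map_pow, AlgEquiv.commutes, hsπ]
    linear_combination (-(algebraMap F E q) ^ 2) * (- hMT)

/-- valuation of `p + q ϖ` -/
lemma w_rep (hv : DiscreteVal F v) (hw : DiscreteVal E w)
    (hram : ∀ a : F, w (algebraMap F E a) = 2 • v a) {π : E} (hπ : w π = ((1 : ℤ) : WithTop ℤ))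
    (p q : F) : w (algebraMap F E p + algebraMap F E q * π) =
      min (w (algebraMap F E p)) (w (algebraMap F E q) + ((1 : ℤ) : WithTop ℤ)) := by
  by_cases hp : p = 0
  · rw [hp, map_zero, zero_add, hw.1, hw.2.2.1, hπ]; simp
  by_cases hq : q = 0
  · rw [hq, map_zero, zero_mul, add_zero, hw.1]; simp
  obtain ⟨i, hi⟩ := vex hv hp
  obtain ⟨j, hj⟩ := vex hv hq
  have hi' := w_of_v hram hi
  have hj' := w_of_v hram hj
  have hq' := vmul hw hj' hπ
  rw [hi', hj', ← WithTop.coe_add]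
  rcases lt_trichotomy (2 * i) (2 * j + 1) with hlt | heq | hgt
  · have hl : ((2 * i : ℤ) : WithTop ℤ) < ((2 * j + 1 : ℤ) : WithTop ℤ) := by exact_mod_cast hlt
    rw [min_eq_left hl.le]
    exact vadd_eq hw hi' (by rwa [hq'])
  · omega
  · have hl : ((2 * j + 1 : ℤ) : WithTop ℤ) < ((2 * i : ℤ) : WithTop ℤ) := by exact_mod_cast hgt
    rw [min_eq_right hl.le, add_comm]
    exact vadd_eq hw hq' (by rwa [hi'])

lemma w_s (hv : DiscreteVal F v) (hw : DiscreteVal E w)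
    (hram : ∀ a : F, w (algebraMap F E a) = 2 • v a) (s : E ≃ₐ[F] E) {π : E}
    (hπ : w π = ((1 : ℤ) : WithTop ℤ)) (hsπ : w (s π) = ((1 : ℤ) : WithTop ℤ))
    (hrep : ∀ z : E, ∃ p q : F, z = algebraMap F E p + algebraMap F E q * π) (z : E) :
    w (s z) = w z := by
  obtain ⟨p, q, rfl⟩ := hrep z
  simp only [map_add, map_mul, AlgEquiv.commutes]
  rw [w_rep hv hw hram hπ, w_rep hv hw hram hsπ]

lemma w_tr (hv : DiscreteVal F v) (hw : DiscreteVal E w)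
    (hram : ∀ a : F, w (algebraMap F E a) = 2 • v a)
    {e : ℤ} (he : v 2 = (e : WithTop ℤ)) (s : E ≃ₐ[F] E) {π : E}
    (hπ : w π = ((1 : ℤ) : WithTop ℤ))
    {b : ℤ} (hb : w (s π - π) = ((b + 1 : ℤ) : WithTop ℤ)) (hbe : b < 2 * e)
    (hrep : ∀ z : E, ∃ p q : F, z = algebraMap F E p + algebraMap F E q * π) {z : E} {n : ℤ}
    (hz : w z = (n : WithTop ℤ)) :
    ((n + b : ℤ) : WithTop ℤ) ≤ w (z + s z) ∧
      (Odd n → w (z + s z) = ((n + b : ℤ) : WithTop ℤ)) := by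
  have hw2 : w 2 = ((2 * e : ℤ) : WithTop ℤ) := by
    rw [← w_of_v hram he]; congr 1; exact (map_ofNat _ 2).symm
  have h2z : ((n + b : ℤ) : WithTop ℤ) < w (2 * z) := by
    rw [vmul hw hw2 hz]
    have : n + b < 2 * e + n := by omega
    exact_mod_cast this
  have hsum : z + s z = (s z - z) + 2 * z := by ring
  obtain ⟨p, q, hpq⟩ := hrep z
  have hdiff : s z - z = algebraMap F E q * (s π - π) := by
    rw [hpq]
    simp only [map_add, map_mul, AlgEquiv.commutes]
    ring
  have hmin := w_rep hv hw hram hπ p q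
  rw [← hpq, hz] at hmin
  have hmain : ((n + b : ℤ) : WithTop ℤ) ≤ w (s z - z) ∧
      (Odd n → w (s z - z) = ((n + b : ℤ) : WithTop ℤ)) := by
    by_cases hq : q = 0
    · rw [hq, map_zero, zero_mul] at hdiff
      rw [hdiff, hw.1]
      refine ⟨le_top, fun hodd => ?_⟩
      rw [hq, map_zero, hw.1] at hmin
      simp only [WithTop.top_add, le_top, inf_of_le_left] at hmin
      obtain ⟨m, -, hm⟩ := even_w hv hw hram hmin.symm
      obtain ⟨k, hk⟩ := hodd
      omega
    · obtain ⟨j, hj⟩ := vex hv hq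
      have hj' := w_of_v hram hj
      have hd := vmul hw hj' hb
      rw [hj', ← WithTop.coe_add] at hmin
      rw [hdiff, hd]
      have hle : (n : WithTop ℤ) ≤ ((2 * j + 1 : ℤ) : WithTop ℤ) := by
        rw [hmin]; exact min_le_right _ _
      have hle' : n ≤ 2 * j + 1 := by exact_mod_cast hle
      constructor
      · have : n + b ≤ 2 * j + (b + 1) := by omega
        exact_mod_cast this
      · rintro ⟨k, hk⟩
        rcases min_choice (w (algebraMap F E p)) ((2 * j + 1 : ℤ) : WithTop ℤ) with h | h
        · rw [h] at hmin
          obtain ⟨m, -, hm⟩ := even_w hv hw hram hmin.symm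
          omega
        · rw [h] at hmin
          have : n = 2 * j + 1 := by exact_mod_cast hmin
          congr 1
          omega
  rw [hsum]
  refine ⟨vadd_ge hw hmain.1 h2z.le, fun hodd => vadd_eq hw (hmain.2 hodd) h2z⟩

lemma norm_level (hv : DiscreteVal F v) (hw : DiscreteVal E w)
    (hram : ∀ a : F, w (algebraMap F E a) = 2 • v a) (s : E ≃ₐ[F] E) {π : E}
    (hπ : w π = ((1 : ℤ) : WithTop ℤ)) (hws : ∀ z, w (s z) = w z)
    (hN : ∀ z : E, ∃ ν : F, algebraMap F E ν = z * s z)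
    (hperf : ∀ a : F, v a = ((0 : ℤ) : WithTop ℤ) → ∃ t : F, ((0 : ℤ) : WithTop ℤ) < v (t ^ 2 - a))
    {r : F} {n : ℤ} (hr : v r = (n : WithTop ℤ)) :
    ∃ y : E, w y = (n : WithTop ℤ) ∧
      ((2 * n + 2 : ℤ) : WithTop ℤ) ≤ w (y * s y - algebraMap F E r) := by
  obtain ⟨ν, hν⟩ := hN π
  have hvν : v ν = ((1 : ℤ) : WithTop ℤ) := by
    have h1 := vmul hw hπ ((hws π).trans hπ)
    rw [← hν] at h1
    obtain ⟨m, hm, hm'⟩ := even_w hv hw hram h1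
    rw [hm]; congr 1; omega
  have hνn := vzpow hv hvν n
  have hνn0 := vne hv hνn
  have ha := vdiv hv hr hνn
  rw [show n - n * 1 = 0 by ring] at ha
  obtain ⟨t, ht⟩ := hperf _ ha
  have ht2 : v (t ^ 2) = ((0 : ℤ) : WithTop ℤ) := by
    have := vadd_eq hv ha ht
    rwa [add_sub_cancel] at this
  have ht0 : t ≠ 0 := by rintro rfl; exact vne hv ht2 (by simp)
  obtain ⟨m, hm⟩ := vex hv ht0
  have hm2 := vpow hv hm 2
  rw [ht2] at hm2
  have hm0 : m = 0 := by
    have : (0 : ℤ) = ((2 : ℕ) : ℤ) * m := by exact_mod_cast hm2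
    push_cast at this; omega
  subst hm0
  refine ⟨algebraMap F E t * π ^ n, ?_, ?_⟩
  · rw [vmul hw (w_of_v hram hm) (vzpow hw hπ n)]; congr 1; ring
  · have hid : algebraMap F E t * π ^ n * s (algebraMap F E t * π ^ n) - algebraMap F E r =
        algebraMap F E (ν ^ n) * algebraMap F E (t ^ 2 - r / ν ^ n) := by
      rw [← map_mul, mul_sub, mul_div_cancel₀ _ hνn0, map_sub, map_mul, map_mul, map_zpow₀,
        map_zpow₀, AlgEquiv.commutes, hν, mul_zpow, map_pow]
      ring
    rw [hid]
    have := vmul_ge hw (w_of_v hram hνn).ge (gt_of_w hv hram ht)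
    refine le_trans ?_ this
    have : 2 * n + 2 ≤ 2 * (n * 1) + (2 * 0 + 2) := by omega
    exact_mod_cast this

lemma norm_approx (hv : DiscreteVal F v) (hw : DiscreteVal E w)
    (hram : ∀ a : F, w (algebraMap F E a) = 2 • v a) (s : E ≃ₐ[F] E) {π : E}
    (hπ : w π = ((1 : ℤ) : WithTop ℤ)) (hws : ∀ z, w (s z) = w z)
    (hN : ∀ z : E, ∃ ν : F, algebraMap F E ν = z * s z)
    (hperf : ∀ a : F, v a = ((0 : ℤ) : WithTop ℤ) → ∃ t : F, ((0 : ℤ) : WithTop ℤ) < v (t ^ 2 - a))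
    {b : ℤ} (htr : ∀ (z : E) (n : ℤ), w z = (n : WithTop ℤ) →
      ((n + b : ℤ) : WithTop ℤ) ≤ w (z + s z))
    {u : F} {m : ℤ} (hu : v u = (m : WithTop ℤ)) (n : ℕ) (hn : 1 ≤ n) : (n : ℤ) ≤ b →
    ∃ x : E, w x = (m : WithTop ℤ) ∧
      ((2 * (m + n) : ℤ) : WithTop ℤ) ≤ w (algebraMap F E u - x * s x) := by
  induction n, hn using Nat.le_induction with
  | base =>
    intro _
    obtain ⟨y, hy, hy2⟩ := norm_level hv hw hram s hπ hws hN hperf hu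
    refine ⟨y, hy, ?_⟩
    rw [← vneg hw, neg_sub]
    refine le_trans (le_of_eq ?_) hy2
    congr 1
    push_cast; ring
  | succ n hn ih =>
    intro hnb
    push_cast at hnb
    obtain ⟨x, hx, hx2⟩ := ih (by omega)
    obtain ⟨ν, hν⟩ := hN x
    have hwν := vmul hw hx ((hws x).trans hx)
    rw [← hν] at hwν
    obtain ⟨m', hvν, hm'⟩ := even_w hv hw hram hwν
    obtain rfl : m = m' := by omega
    have hν0 := vne hv hvν
    have hEν : algebraMap F E ν ≠ 0 := by simpa using hν0
    by_cases hr0 : u - ν = 0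
    · refine ⟨x, hx, ?_⟩
      rw [← hν, ← map_sub, hr0, map_zero, hw.1]; exact le_top
    obtain ⟨j, hj⟩ := vex hv hr0
    rw [← hν, ← map_sub, w_of_v hram hj] at hx2
    have hj2 : 2 * (m + n) ≤ 2 * j := by exact_mod_cast hx2
    by_cases hjn : j = m + n
    swap
    · refine ⟨x, hx, ?_⟩
      rw [← hν, ← map_sub, w_of_v hram hj]
      have : 2 * (m + ((n + 1 : ℕ) : ℤ)) ≤ 2 * j := by push_cast; omega
      exact_mod_cast this
    have hr := vdiv hv hj hvν
    rw [show j - m = n by omega] at hr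
    obtain ⟨y, hy, hy2⟩ := norm_level hv hw hram s hπ hws hN hperf hr
    have htry := htr y _ hy
    have h1y : w (1 + y) = ((0 : ℤ) : WithTop ℤ) := by
      apply vadd_eq hw (vone hw)
      rw [hy]
      have : (0 : ℤ) < n := by omega
      exact_mod_cast this
    refine ⟨x * (1 + y), ?_, ?_⟩
    · rw [vmul hw hx h1y, add_zero]
    · have hid : algebraMap F E u - x * (1 + y) * s (x * (1 + y)) =
          algebraMap F E ν * (-((y * s y - algebraMap F E ((u - ν) / ν)) + (y + s y))) := by
        have h1 : algebraMap F E u = algebraMap F E ν * (1 + algebraMap F E ((u - ν) / ν)) := by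
          rw [map_div₀, map_sub]; field_simp; ring
        rw [h1, map_mul, map_add, map_one]
        rw [show x * (1 + y) * (s x * (1 + s y)) = (x * s x) * ((1 + y) * (1 + s y)) by ring, ← hν]
        ring
      rw [hid]
      have hge : ((2 * n + 2 : ℤ) : WithTop ℤ) ≤
          w (-((y * s y - algebraMap F E ((u - ν) / ν)) + (y + s y))) := by
        rw [vneg hw]
        apply vadd_ge hw hy2
        obtain ⟨ν₁, hν₁⟩ := hN (1 + y)
        obtain ⟨ν₂, hν₂⟩ := hN y
        have hyF : y + s y = algebraMap F E (ν₁ - ν₂ - 1) := by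
          rw [map_sub, map_sub, hν₁, hν₂, map_add, map_one, map_one]; ring
        rw [hyF] at htry ⊢
        by_cases hz : algebraMap F E (ν₁ - ν₂ - 1) = 0
        · rw [hz, hw.1]; exact le_top
        obtain ⟨k, hk⟩ := vex hw hz
        obtain ⟨k', -, hk'⟩ := even_w hv hw hram hk
        rw [hk] at htry ⊢
        have h1 : (n : ℤ) + b ≤ k := by exact_mod_cast htry
        have h2 : 2 * (n : ℤ) + 2 ≤ k := by omega
        exact_mod_cast h2
      have := vmul_ge hw hwν.ge hge
      refine le_trans (le_of_eq ?_) this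
      congr 1
      push_cast; omega
end ext
end DG

open DG in
/-- Let `E/F` be a ramified quadratic extension of 2-adic fields with odd break number
`b`, and `κ ∈ F* \ (E*)²`.  Then `def_E(κ) ≥ min (2 def_F(κ) + b) (def_F(κ) + 2 e_F)`,
with equality whenever `def_F(κ) ≠ 2 e_F - b`. -/
theorem defect_growth_in_ramified_quadratic
    (F : Type*) [Field F] [Algebra ℚ_[2] F] [FiniteDimensional ℚ_[2] F]
    (vF : F → WithTop ℤ) (hvF : DiscreteVal F vF)
    (eF : ℤ) (he : vF 2 = (eF : WithTop ℤ))
    (E : Type*) [Field E] [Algebra F E] (hquad : Module.finrank F E = 2)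
    (vE : E → WithTop ℤ) (hvE : DiscreteVal E vE)
    (hram : ∀ a : F, vE (algebraMap F E a) = 2 • vF a)
    (s : E ≃ₐ[F] E) (hs : s ≠ 1)
    (πE : E) (hπ : vE πE = 1)
    (b : ℤ) (hbodd : Odd b) (hb : vE (s πE - πE) = ((b + 1 : ℤ) : WithTop ℤ))
    (κ : F) (hκ0 : κ ≠ 0) (hκns : ∀ z : E, z ^ 2 ≠ algebraMap F E κ)
    (dF dE : ℤ)
    (hdF : HasQuadDefect vF κ (dF : WithTop ℤ))
    (hdE : HasQuadDefect vE (algebraMap F E κ) (dE : WithTop ℤ)) :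
    min (2 * dF + b) (dF + 2 * eF) ≤ dE ∧
      (dF ≠ 2 * eF - b → dE = min (2 * dF + b) (dF + 2 * eF)) := by
  have hπ1 : vE πE = ((1 : ℤ) : WithTop ℤ) := hπ
  obtain ⟨hb1, hbe, hsπ, hrep, hN⟩ :=
    structure_lemma hvF hvE hram he hquad s πE hπ1 b hbodd hb
  have hws := w_s hvF hvE hram s hπ1 hsπ hrep
  have hepos : 0 < eF := by omega
  have htr := fun (z : E) (n : ℤ) (hz : vE z = (n : WithTop ℤ)) =>
    w_tr hvF hvE hram he s hπ1 hb hbe hrep hz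
  have hperf := fun (a : F) ha => perfect hvF he hepos (a := a) ha
  have hw2 : vE 2 = ((2 * eF : ℤ) : WithTop ℤ) := by
    rw [← w_of_v hram he]; congr 1; exact (map_ofNat _ 2).symm
  have happrox : ∀ (u : F) (m : ℤ), vF u = (m : WithTop ℤ) → ∃ x : E, vE x = (m : WithTop ℤ) ∧
      ((2 * (m + b) : ℤ) : WithTop ℤ) ≤ vE (algebraMap F E u - x * s x) := by
    intro u m hu
    have := norm_approx hvF hvE hram s hπ1 hws hN hperf (fun z n hz => (htr z n hz).1) hu
      b.toNat (by omega) (by omega)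
    rwa [Int.toNat_of_nonneg (by omega)] at this
  have : FiniteDimensional F E := FiniteDimensional.of_finrank_pos (by omega)
  let A : Algebra ℚ_[2] E := ((algebraMap F E).comp (algebraMap ℚ_[2] F)).toAlgebra
  have : IsScalarTower ℚ_[2] F E := IsScalarTower.of_algebraMap_eq (fun _ => rfl)
  have : FiniteDimensional ℚ_[2] E := FiniteDimensional.trans ℚ_[2] F E
  have hκE : algebraMap F E κ ≠ 0 := by simpa using hκ0
  -- upper bounds on the defects
  have hdE4 : dE ≤ 4 * eF := by
    by_contra hcon
    obtain ⟨k, hk⟩ := hdE.1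
    obtain ⟨y, hy⟩ := hensel hvE hw2 (by omega) (x := k ^ 2 * algebraMap F E κ) (by
      rw [hk]
      have : 2 * (2 * eF) < dE := by omega
      exact_mod_cast this)
    have hk0 : k ≠ 0 := by
      rintro rfl
      rw [zero_pow two_ne_zero, zero_mul, zero_sub, vneg hvE, vone hvE] at hk
      have : 0 = dE := by exact_mod_cast hk
      omega
    apply hκns (y / k)
    rw [div_pow, hy]; field_simp
  have hdF2 : dF ≤ 2 * eF := by
    by_contra hcon
    obtain ⟨k, hk⟩ := hdF.1
    have h1 : vE ((algebraMap F E k) ^ 2 * algebraMap F E κ - 1) = ((2 * dF : ℤ) : WithTop ℤ) := by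
      rw [← w_of_v hram hk]; congr 1; simp
    have h2 : ((2 * dF : ℤ) : WithTop ℤ) ≤ (dE : WithTop ℤ) := hdE.2 ⟨_, h1⟩
    have : 2 * dF ≤ dE := by exact_mod_cast h2
    omega
  have hdF0 : 0 ≤ dF := by
    have h1 : ((0 : ℤ) : WithTop ℤ) ≤ (dF : WithTop ℤ) := hdF.2 ⟨0, by
      rw [zero_pow two_ne_zero, zero_mul, zero_sub, vneg hvF, vone hvF]⟩
    exact_mod_cast h1
  obtain ⟨c, hc⟩ := hbodd
  obtain ⟨ϖ, hϖ⟩ := hvF.2.2.2.2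
  have hϖ1 : vF ϖ = ((1 : ℤ) : WithTop ℤ) := hϖ
  rcases eq_or_lt_of_le hdF2 with hd2 | hd2
  · -- maximal defect
    obtain ⟨k, hk⟩ := hdF.1
    have h1 : vE ((algebraMap F E k) ^ 2 * algebraMap F E κ - 1) = ((2 * dF : ℤ) : WithTop ℤ) := by
      rw [← w_of_v hram hk]; congr 1; simp
    have h2 : ((2 * dF : ℤ) : WithTop ℤ) ≤ (dE : WithTop ℤ) := hdE.2 ⟨_, h1⟩
    have : 2 * dF ≤ dE := by exact_mod_cast h2
    omega
  rcases eq_or_lt_of_le hdF0 with hd0 | hd0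
  · -- odd valuation
    obtain ⟨m, hm⟩ := vex hvF hκ0
    have hmodd : Odd m := by
      rw [← Int.not_even_iff_odd]
      rintro ⟨i, hi⟩
      have ha := vinv hvF (vmul hvF (vpow hvF (vzpow hvF hϖ1 (-i)) 2) hm)
      rw [show -(((2 : ℕ) : ℤ) * (-i * 1) + m) = 0 by push_cast; omega] at ha
      obtain ⟨t, ht⟩ := hperf _ ha
      set A := (ϖ ^ (-i)) ^ 2 * κ with hA
      have hA1 := vinv hvF ha
      rw [inv_inv] at hA1
      have hA0 := vne hvF hA1
      have h1 : ((1 : ℤ) : WithTop ℤ) ≤ vF (t ^ 2 - A⁻¹) := by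
        by_cases hz : t ^ 2 - A⁻¹ = 0
        · rw [hz, hvF.1]; exact le_top
        obtain ⟨k, hk⟩ := vex hvF hz
        rw [hk] at ht ⊢
        have : 0 < k := by exact_mod_cast ht
        have : 1 ≤ k := by omega
        exact_mod_cast this
      have h2 := vmul_ge hvF h1 hA1.ge
      have h3 : (t ^ 2 - A⁻¹) * A = (t * ϖ ^ (-i)) ^ 2 * κ - 1 := by
        rw [sub_mul, inv_mul_cancel₀ hA0, hA]; ring
      rw [h3] at h2
      have h4 := h2.trans (hdF.2 ⟨_, rfl⟩)
      have : (1 : ℤ) + -0 ≤ dF := by exact_mod_cast h4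
      omega
    have hm' : vF (-κ) = (m : WithTop ℤ) := by rw [vneg hvF, hm]
    obtain ⟨x, hx, hx2⟩ := happrox _ _ hm'
    have hx0 := vne hvE hx
    have htx := (htr x m hx).2 hmodd
    have h1 := vmul hvE htx hx
    have h2 : vE (algebraMap F E κ - x ^ 2) = ((m + b + m : ℤ) : WithTop ℤ) := by
      have hid : algebraMap F E κ - x ^ 2 =
          -((x + s x) * x + (algebraMap F E (-κ) - x * s x)) := by
        rw [map_neg]; ring
      rw [hid, vneg hvE]
      apply vadd_eq hvE h1
      refine lt_of_lt_of_le ?_ hx2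
      have : m + b + m < 2 * (m + b) := by omega
      exact_mod_cast this
    have h3 := vdiv hvE h2 (vpow hvE hx 2)
    have h4 : vE ((x⁻¹) ^ 2 * algebraMap F E κ - 1) = (b : WithTop ℤ) := by
      have hid : (x⁻¹) ^ 2 * algebraMap F E κ - 1 = (algebraMap F E κ - x ^ 2) / x ^ 2 := by
        field_simp
      rw [hid, h3]; congr 1; push_cast; ring
    have h5 := odd_defect hvE hw2 hdE _ h4 ⟨c, hc⟩ (by omega) (by omega)
    omega
  · -- intermediate odd defect
    obtain ⟨k, hk⟩ := hdF.1
    set a := k ^ 2 * κ - 1 with ha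
    have hκa : k ^ 2 * κ = 1 + a := by rw [ha]; ring
    have hdodd : Odd dF := by
      rw [← Int.not_even_iff_odd]
      rintro ⟨i, hi⟩
      have hϖi := vzpow hvF hϖ1 i
      have hq := vdiv hvF hk (vpow hvF hϖi 2)
      rw [show dF - ((2 : ℕ) : ℤ) * (i * 1) = 0 by push_cast; omega] at hq
      obtain ⟨t, ht⟩ := hperf _ hq
      have h1 : ((1 : ℤ) : WithTop ℤ) ≤ vF (t ^ 2 - a / (ϖ ^ i) ^ 2) := by
        by_cases hz : t ^ 2 - a / (ϖ ^ i) ^ 2 = 0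
        · rw [hz, hvF.1]; exact le_top
        obtain ⟨k, hk⟩ := vex hvF hz
        rw [hk] at ht ⊢
        have : 0 < k := by exact_mod_cast ht
        have : 1 ≤ k := by omega
        exact_mod_cast this
      have hϖ0 : ϖ ^ i ≠ 0 := vne hvF hϖi
      have ht0 : ((0 : ℤ) : WithTop ℤ) ≤ vF t := by
        by_cases hz : t = 0
        · rw [hz, hvF.1]; exact le_top
        obtain ⟨j, hj⟩ := vex hvF hz
        have hj2 := vpow hvF hj 2
        have h3 := vadd_ge hvF ht.le hq.ge
        rw [sub_add_cancel, hj2] at h3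
        have : 0 ≤ ((2 : ℕ) : ℤ) * j := by exact_mod_cast h3
        rw [hj]
        have : 0 ≤ j := by push_cast at this; omega
        exact_mod_cast this
      have hcge := vmul_ge hvF ht0 hϖi.ge
      set C := t * ϖ ^ i with hC
      have hC1 : vF (1 + C) = ((0 : ℤ) : WithTop ℤ) := by
        apply vadd_eq hvF (vone hvF)
        refine lt_of_lt_of_le ?_ hcge
        have : 0 < 0 + i * 1 := by omega
        exact_mod_cast this
      have hC0 := vne hvF hC1
      have h2C := vmul_ge hvF he.ge hcge
      have hdiff := vmul_ge hvF h1 (vpow hvF hϖi 2).ge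
      have hid : (k / (1 + C)) ^ 2 * κ - 1 =
          -((t ^ 2 - a / (ϖ ^ i) ^ 2) * (ϖ ^ i) ^ 2 + 2 * C) * ((1 + C) ^ 2)⁻¹ := by
        have e1 : (t ^ 2 - a / (ϖ ^ i) ^ 2) * (ϖ ^ i) ^ 2 = C ^ 2 - a := by
          rw [hC]; field_simp
        rw [e1, div_pow, div_mul_eq_mul_div, hκa]
        field_simp
        ring
      have hsum : ((dF + 1 : ℤ) : WithTop ℤ) ≤
          vF (-((t ^ 2 - a / (ϖ ^ i) ^ 2) * (ϖ ^ i) ^ 2 + 2 * C)) := by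
        rw [vneg hvF]
        apply vadd_ge hvF
        · refine le_trans ?_ hdiff
          have : dF + 1 ≤ 1 + ((2 : ℕ) : ℤ) * (i * 1) := by push_cast; omega
          exact_mod_cast this
        · refine le_trans ?_ h2C
          have : dF + 1 ≤ eF + (0 + i * 1) := by omega
          exact_mod_cast this
      have hfin := vmul_ge hvF hsum (vinv hvF (vpow hvF hC1 2)).ge
      rw [← hid] at hfin
      have h4 := hfin.trans (hdF.2 ⟨_, rfl⟩)
      have : dF + 1 + -(((2 : ℕ) : ℤ) * 0) ≤ dF := by exact_mod_cast h4
      omega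
    have hma : vF (-a) = (dF : WithTop ℤ) := by rw [vneg hvF, hk]
    obtain ⟨x, hx, hx2⟩ := happrox _ _ hma
    have htx := (htr x dF hx).2 hdodd
    have h1 := vmul hvE htx hx
    have h2 := vmul hvE hw2 hx
    have h1x : vE (1 + x) = ((0 : ℤ) : WithTop ℤ) := by
      apply vadd_eq hvE (vone hvE)
      rw [hx]; exact_mod_cast hd0
    have h1x0 := vne hvE h1x
    set R := algebraMap F E (-a) - x * s x with hR
    have hid : (algebraMap F E k / (1 + x)) ^ 2 * algebraMap F E κ - 1 =
        -(((x + s x) * x + R) + 2 * x) * ((1 + x) ^ 2)⁻¹ := by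
      have e1 : algebraMap F E k ^ 2 * algebraMap F E κ = 1 + algebraMap F E a := by
        rw [← map_pow, ← map_mul, hκa, map_add, map_one]
      rw [div_pow, div_mul_eq_mul_div, e1, hR, map_neg]
      field_simp
      ring
    have hRlt : ((dF + b + dF : ℤ) : WithTop ℤ) < vE R := by
      refine lt_of_lt_of_le ?_ hx2
      have : dF + b + dF < 2 * (dF + b) := by omega
      exact_mod_cast this
    have h3 : vE ((x + s x) * x + R) = ((dF + b + dF : ℤ) : WithTop ℤ) := vadd_eq hvE h1 hRlt
    have hinv := vinv hvE (vpow hvE h1x 2)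
    have hlow : ((min (2 * dF + b) (dF + 2 * eF) : ℤ) : WithTop ℤ) ≤
        vE (-(((x + s x) * x + R) + 2 * x)) := by
      rw [vneg hvE]
      apply vadd_ge hvE
      · rw [h3]
        have : min (2 * dF + b) (dF + 2 * eF) ≤ dF + b + dF := by omega
        exact_mod_cast this
      · rw [h2]
        have : min (2 * dF + b) (dF + 2 * eF) ≤ 2 * eF + dF := by omega
        exact_mod_cast this
    constructor
    · have h4 := vmul_ge hvE hlow hinv.ge
      rw [← hid] at h4
      have h5 := h4.trans (hdE.2 ⟨_, rfl⟩)
      have : min (2 * dF + b) (dF + 2 * eF) + -(((2 : ℕ) : ℤ) * 0) ≤ dE := by exact_mod_cast h5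
      omega
    · intro hne
      have heq : vE (-(((x + s x) * x + R) + 2 * x)) =
          ((min (2 * dF + b) (dF + 2 * eF) : ℤ) : WithTop ℤ) := by
        rw [vneg hvE]
        rcases lt_or_ge (dF + b + dF) (2 * eF + dF) with hlt | hge
        · rw [vadd_eq hvE h3 (by rw [h2]; exact_mod_cast hlt)]
          congr 1; omega
        · have hgt : 2 * eF + dF < dF + b + dF := by omega
          rw [add_comm, vadd_eq hvE h2 (by rw [h3]; exact_mod_cast hgt)]
          congr 1; omega
      have h4 := vmul hvE heq hinv
      rw [← hid] at h4
      have h5 : min (2 * dF + b) (dF + 2 * eF) + -(((2 : ℕ) : ℤ) * 0) =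
          min (2 * dF + b) (dF + 2 * eF) := by ring
      rw [h5] at h4
      obtain ⟨i, hi⟩ := hdodd
      refine odd_defect hvE hw2 hdE _ h4 ?_ (by omega) (by omega)
      rcases min_choice (2 * dF + b) (dF + 2 * eF) with h | h <;> rw [h]
      · exact ⟨dF + c, by omega⟩
      · exact ⟨i + eF, by omega⟩
end

section
/- Let E/F be a ramified quadratic extension with odd break b, κ ∈ F* \ (E*)², and suppose def_F(κ) ≥ δ for some δ ≥ 0. Then def_E(κ) ≥ min{2δ + b, δ + 2e_F} ≥ b. -/
namespace DGT

section basic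
variable {K : Type*} [Field K] {v : K → WithTop ℤ}

lemma exists_int (h : DiscreteVal K v) {x : K} (hx : x ≠ 0) : ∃ n : ℤ, v x = (n : WithTop ℤ) := by
  have : v x ≠ ⊤ := fun h' => hx (h.2.1 x h')
  obtain ⟨n, hn⟩ := WithTop.ne_top_iff_exists.mp this
  exact ⟨n, hn.symm⟩

lemma ne_zero (h : DiscreteVal K v) {x : K} {n : ℤ} (hx : v x = (n : WithTop ℤ)) : x ≠ 0 := by
  rintro rfl
  rw [h.1] at hx
  exact WithTop.top_ne_coe hx

lemma mul_eq (h : DiscreteVal K v) {x y : K} {m n : ℤ} (hx : v x = (m : WithTop ℤ))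
    (hy : v y = (n : WithTop ℤ)) : v (x * y) = ((m + n : ℤ) : WithTop ℤ) := by
  rw [h.2.2.1, hx, hy]; rfl

lemma mul_ge (h : DiscreteVal K v) {x y : K} {m n : ℤ} (hx : (m : WithTop ℤ) ≤ v x)
    (hy : (n : WithTop ℤ) ≤ v y) : ((m + n : ℤ) : WithTop ℤ) ≤ v (x * y) := by
  rw [h.2.2.1, WithTop.coe_add]; exact add_le_add hx hy

lemma val_one (h : DiscreteVal K v) : v 1 = ((0 : ℤ) : WithTop ℤ) := by
  obtain ⟨n, hn⟩ := exists_int h (one_ne_zero (α := K))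
  have := mul_eq h hn hn
  rw [mul_one, hn] at this
  have : n = n + n := by exact_mod_cast this
  rw [hn]; congr 1; omega

lemma val_neg_one (h : DiscreteVal K v) : v (-1) = ((0 : ℤ) : WithTop ℤ) := by
  obtain ⟨n, hn⟩ := exists_int h (neg_ne_zero.mpr (one_ne_zero (α := K)))
  have := mul_eq h hn hn
  rw [neg_mul_neg, mul_one, val_one h] at this
  have : 0 = n + n := by exact_mod_cast this
  rw [hn]; congr 1; omega

lemma val_neg (h : DiscreteVal K v) (x : K) : v (-x) = v x := by
  rw [← neg_one_mul, h.2.2.1, val_neg_one h]; simp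

lemma add_ge (h : DiscreteVal K v) {x y : K} {n : WithTop ℤ} (hx : n ≤ v x)
    (hy : n ≤ v y) : n ≤ v (x + y) := (le_min hx hy).trans (h.2.2.2.1 x y)

lemma sub_ge (h : DiscreteVal K v) {x y : K} {n : WithTop ℤ} (hx : n ≤ v x)
    (hy : n ≤ v y) : n ≤ v (x - y) := by
  rw [sub_eq_add_neg]; exact add_ge h hx (by rwa [val_neg h])

lemma add_eq (h : DiscreteVal K v) {x y : K} {n : ℤ} (hx : v x = (n : WithTop ℤ))
    (hy : ((n + 1 : ℤ) : WithTop ℤ) ≤ v y) : v (x + y) = (n : WithTop ℤ) := by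
  have hn : ((n : ℤ) : WithTop ℤ) ≤ ((n + 1 : ℤ) : WithTop ℤ) := by exact_mod_cast (by omega)
  apply le_antisymm
  · by_contra hc
    rw [not_le] at hc
    have h1 : ((n + 1 : ℤ) : WithTop ℤ) ≤ v (x + y) := by
      by_cases ht : x + y = 0
      · rw [ht, h.1]; exact le_top
      · obtain ⟨m, hm⟩ := exists_int h ht
        rw [hm] at hc ⊢
        have : n < m := by exact_mod_cast hc
        exact_mod_cast (by omega : n + 1 ≤ m)
    have h2 := sub_ge h h1 hy
    rw [add_sub_cancel_right, hx] at h2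
    have : n + 1 ≤ n := by exact_mod_cast h2
    omega
  · exact add_ge h hx.ge (hn.trans hy)

lemma inv_eq (h : DiscreteVal K v) {x : K} {m : ℤ} (hx : v x = (m : WithTop ℤ)) :
    v x⁻¹ = ((-m : ℤ) : WithTop ℤ) := by
  have h0 := ne_zero h hx
  obtain ⟨n, hn⟩ := exists_int h (inv_ne_zero h0)
  have := mul_eq h hx hn
  rw [mul_inv_cancel₀ h0, val_one h] at this
  have : 0 = m + n := by exact_mod_cast this
  rw [hn]; congr 1; omega

lemma pow_eq (h : DiscreteVal K v) {x : K} {m : ℤ} (hx : v x = (m : WithTop ℤ)) (k : ℕ) :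
    v (x ^ k) = ((k * m : ℤ) : WithTop ℤ) := by
  induction k with
  | zero => simpa using val_one h
  | succ k ih => rw [pow_succ, mul_eq h ih hx]; congr 1; push_cast; ring

lemma zpow_eq (h : DiscreteVal K v) {x : K} {m : ℤ} (hx : v x = (m : WithTop ℤ)) (k : ℤ) :
    v (x ^ k) = ((k * m : ℤ) : WithTop ℤ) := by
  cases k with
  | ofNat k => simpa using pow_eq h hx k
  | negSucc k =>
    rw [zpow_negSucc, inv_eq h (pow_eq h hx _)]; congr 1; 
    rw [Int.negSucc_eq]; push_cast; ring

lemma coe_le_of_lt {n : ℤ} {w : WithTop ℤ} (h : (n : WithTop ℤ) < w) :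
    ((n + 1 : ℤ) : WithTop ℤ) ≤ w := by
  cases w with
  | top => exact le_top
  | coe m =>
    have : n < m := by exact_mod_cast h
    exact_mod_cast (by omega : n + 1 ≤ m)

end basic

section padic
variable {F : Type*} [Field F] [Algebra ℚ_[2] F] {v : F → WithTop ℤ}

lemma norm_two_aux : ‖((2 : ℕ) : ℤ_[2])‖ < 1 := by
  rw [PadicInt.norm_p]; norm_num

lemma exists_root (z : ℤ_[2]) (n : ℕ) (hn : Odd n) : ∃ w : ℤ_[2], w ^ n = 1 + 2 * z := by
  have hnorm : ‖(n : ℤ_[2])‖ = 1 := by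
    have := PadicInt.norm_natCast_eq_one_iff (p := 2) (n := n)
    rw [this]
    exact (Nat.coprime_two_left).mpr hn
  have h2 : ‖(2 : ℤ_[2]) * z‖ < 1 := by
    rw [norm_mul]
    have h2 : ‖(2 : ℤ_[2])‖ < 1 := by
      have := norm_two_aux
      simpa using this
    have := PadicInt.norm_le_one z
    nlinarith [norm_nonneg (2 : ℤ_[2]), norm_nonneg z]
  have := hensels_lemma (p := 2) (R := ℤ_[2]) (F := (Polynomial.X ^ n - Polynomial.C (1 + 2 * z)))
    (a := (1 : ℤ_[2])) (by
      simp [Polynomial.derivative_X_pow, hnorm]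
      simpa using h2)
  obtain ⟨w, hw, -⟩ := this
  refine ⟨w, ?_⟩
  simpa [sub_eq_zero] using hw

noncomputable abbrev ι (F : Type*) [Field F] [Algebra ℚ_[2] F] : ℤ_[2] →+* F :=
  (algebraMap ℚ_[2] F).comp (PadicInt.Coe.ringHom)

lemma iota_inj : Function.Injective (ι F) :=
  (algebraMap ℚ_[2] F).injective.comp Subtype.coe_injective

lemma val_one_add (h : DiscreteVal F v) (z : ℤ_[2]) :
    v (ι F (1 + 2 * z)) = ((0 : ℤ) : WithTop ℤ) := by
  have h0 : (1 + 2 * z) ≠ 0 := by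
    intro h0
    have h2 : ‖(2 : ℤ_[2])‖ < 1 := by
      have := norm_two_aux
      simpa using this
    have : (2 : ℤ_[2]) * (-z) = 1 := by linear_combination -h0
    have h3 := congrArg norm this
    rw [norm_mul, norm_one] at h3
    have := PadicInt.norm_le_one (-z)
    nlinarith [norm_nonneg (2 : ℤ_[2]), norm_nonneg (-z)]
  obtain ⟨m, hm⟩ := exists_int h ((map_ne_zero_iff _ (iota_inj (F := F))).mpr h0)
  rw [hm]; congr 1
  obtain ⟨w, hw⟩ := exists_root z (2 * m.natAbs + 1) ⟨_, rfl⟩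
  have hw0 : w ≠ 0 := by
    rintro rfl
    apply h0; rw [← hw]; simp
  obtain ⟨k, hk⟩ := exists_int h ((map_ne_zero_iff _ (iota_inj (F := F))).mpr hw0)
  have := pow_eq h hk (2 * m.natAbs + 1)
  rw [← map_pow, hw, hm] at this
  have : m = ((2 * m.natAbs + 1 : ℕ) : ℤ) * k := by exact_mod_cast this
  have hd : ((2 * m.natAbs + 1 : ℕ) : ℤ) ∣ m := ⟨k, this⟩
  apply Int.eq_zero_of_abs_lt_dvd hd
  push_cast
  have := abs_nonneg m
  linarith

lemma val_iota_nonneg (h : DiscreteVal F v) (z : ℤ_[2]) :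
    ((0 : ℤ) : WithTop ℤ) ≤ v (ι F z) := by
  have key : ∀ z, ((0 : ℤ) : WithTop ℤ) ≤ v (ι F (2 * z)) := by
    intro z
    have := sub_ge h (val_one_add h z).ge (val_one h).ge
    simpa using this
  by_cases hz : z = 0
  · subst hz; rw [map_zero, h.1]; exact le_top
  obtain ⟨m, hm⟩ := exists_int h ((map_ne_zero_iff _ (iota_inj (F := F))).mpr hz)
  have h20 : (2 : ℤ_[2]) ≠ 0 := by norm_num
  obtain ⟨e, he⟩ := exists_int h ((map_ne_zero_iff _ (iota_inj (F := F))).mpr h20)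
  have := key (z ^ (e.natAbs + 1))
  rw [map_mul, map_pow, mul_eq h he (pow_eq h hm _)] at this
  have : 0 ≤ e + ((e.natAbs + 1 : ℕ) : ℤ) * m := by exact_mod_cast this
  rw [hm]
  have : 0 ≤ m := by
    by_contra hc
    push_cast at this
    have h1 : e ≤ |e| := le_abs_self e
    have h2 := abs_nonneg e
    nlinarith
  exact_mod_cast this

/-- the valuation ring -/
def VR (h : DiscreteVal F v) : ValuationSubring F where
  carrier := {x | ((0 : ℤ) : WithTop ℤ) ≤ v x}
  mul_mem' := fun ha hb => by simpa using mul_ge h ha hb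
  one_mem' := (val_one h).ge
  add_mem' := fun ha hb => add_ge h ha hb
  zero_mem' := by simp [h.1]
  neg_mem' := fun {x} hx => by simpa [val_neg h] using hx
  mem_or_inv_mem' := fun x => by
    by_cases hx : x = 0
    · left; simp [hx, h.1]
    obtain ⟨n, hn⟩ := exists_int h hx
    rcases le_total 0 n with h0 | h0
    · left; show _ ≤ v x; rw [hn]; exact_mod_cast h0
    · right; show _ ≤ v x⁻¹; rw [inv_eq h hn]; exact_mod_cast (by omega)

lemma mem_VR (h : DiscreteVal F v) (x : F) : x ∈ VR h ↔ ((0 : ℤ) : WithTop ℤ) ≤ v x := Iff.rfl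

lemma mem_max (h : DiscreteVal F v) (x : VR h) :
    x ∈ IsLocalRing.maximalIdeal (VR h) ↔ ((1 : ℤ) : WithTop ℤ) ≤ v (x : F) := by
  rw [IsLocalRing.mem_maximalIdeal, mem_nonunits_iff]
  constructor
  · intro hu
    by_contra hc
    apply hu
    have hx := (mem_VR h x).mp x.2
    have h0 : v (x : F) = ((0 : ℤ) : WithTop ℤ) := by
      rcases hx.eq_or_lt with h1 | h1
      · exact h1.symm
      · exact absurd (by simpa using coe_le_of_lt h1) hc
    refine IsUnit.of_mul_eq_one ⟨(x : F)⁻¹, ?_⟩ ?_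
    · rw [mem_VR, inv_eq h h0]; simp
    · ext; simp [ne_zero h h0]
  · rintro h1 hu
    obtain ⟨y, hy⟩ := hu.exists_right_inv
    have := mul_ge h h1 ((mem_VR h y).mp y.2)
    have hy' : (x : F) * y = 1 := by simpa using congrArg Subtype.val hy
    rw [hy', val_one h] at this
    have : (1 : ℤ) + 0 ≤ 0 := by exact_mod_cast this
    omega

lemma two_pos [FiniteDimensional ℚ_[2] F] (h : DiscreteVal F v) :
    ((1 : ℤ) : WithTop ℤ) ≤ v 2 := by
  have h2 : ((0 : ℤ) : WithTop ℤ) ≤ v 2 := by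
    have := val_iota_nonneg h 2
    rwa [map_ofNat] at this
  by_contra hc
  have h0 : v 2 = ((0 : ℤ) : WithTop ℤ) := by
    rcases h2.eq_or_lt with h1 | h1
    · exact h1.symm
    · exact absurd (by simpa using coe_le_of_lt h1) hc
  have hQ : ∀ q : ℚ_[2], algebraMap ℚ_[2] F q ∈ VR h := by
    intro q
    obtain ⟨a, b, hb, rfl⟩ := IsFractionRing.div_surjective (A := ℤ_[2]) q
    have hb0 : b ≠ 0 := nonZeroDivisors.ne_zero hb
    obtain ⟨n, u, hu⟩ : ∃ (n : ℕ) (u : ℤ_[2]ˣ), b = u * 2 ^ n :=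
      ⟨b.valuation, PadicInt.unitCoeff hb0, by simpa using PadicInt.unitCoeff_spec hb0⟩
    have e1 : algebraMap ℚ_[2] F (algebraMap ℤ_[2] ℚ_[2] a / algebraMap ℤ_[2] ℚ_[2] b)
      = ι F a * (ι F (↑u⁻¹) * (2⁻¹) ^ n) := by
      have hι : ∀ x : ℤ_[2], algebraMap ℚ_[2] F (algebraMap ℤ_[2] ℚ_[2] x) = ι F x := fun x => rfl
      have hb1 : ι F b ≠ 0 := (map_ne_zero_iff _ (iota_inj (F := F))).mpr hb0
      rw [map_div₀, hι, hι, div_eq_iff hb1]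
      have hu1 : ι F (↑u⁻¹) * ι F u = 1 := by rw [← map_mul]; simp
      have h22 : (2 : F) ≠ 0 := ne_zero h h0
      have : ι F b = ι F u * 2 ^ n := by rw [hu, map_mul, map_pow, map_ofNat]
      rw [this]
      have h3 : ((2 : F)⁻¹) ^ n * 2 ^ n = 1 := by rw [← mul_pow, inv_mul_cancel₀ h22, one_pow]
      linear_combination (-ι F a) * hu1 - ι F a * ι F (↑u⁻¹) * ι F u * h3
    rw [e1]
    refine mul_mem (val_iota_nonneg h a) (mul_mem (val_iota_nonneg h _) (pow_mem ?_ _))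
    rw [mem_VR, inv_eq h h0]; simp
  obtain ⟨π, hπ⟩ := h.2.2.2.2
  have hπ' : v π = ((1 : ℤ) : WithTop ℤ) := hπ
  have hint : IsIntegral ℚ_[2] π⁻¹ := Algebra.IsIntegral.isIntegral _
  obtain ⟨p, hpm, hp⟩ := hint
  let f : ℚ_[2] →+* VR h := (algebraMap ℚ_[2] F).codRestrict (VR h).toSubring hQ
  have : IsIntegral (VR h) π⁻¹ := by
    refine ⟨p.map f, hpm.map f, ?_⟩
    rw [Polynomial.eval₂_map]; exact hp
  obtain ⟨y, hy⟩ := (IsIntegrallyClosed.isIntegral_iff (R := VR h) (K := F)).mp this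
  have h3 := (mem_VR h y).mp y.2
  have hy' : (y : F) = π⁻¹ := hy
  rw [hy', inv_eq h hπ'] at h3
  have : (0 : ℤ) ≤ -1 := by exact_mod_cast h3
  omega

lemma exists_sqrt [FiniteDimensional ℚ_[2] F] (h : DiscreteVal F v) {u : F}
    (hu : ((0 : ℤ) : WithTop ℤ) ≤ v u) : ∃ c : F, ((1 : ℤ) : WithTop ℤ) ≤ v (u - c ^ 2) := by
  let k := IsLocalRing.ResidueField (VR h)
  let f : ℤ_[2] →+* VR h := (ι F).codRestrict (VR h).toSubring (val_iota_nonneg h)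
  let g : ℤ_[2] →+* k := (IsLocalRing.residue (VR h)).comp f
  have hres : ∀ x : VR h, IsLocalRing.residue (VR h) x = 0 ↔ ((1 : ℤ) : WithTop ℤ) ≤ v (x : F) := by
    intro x; rw [IsLocalRing.residue_eq_zero_iff, mem_max]
  have h2k : (2 : k) = 0 := by
    have := (hres 2).mpr (two_pos h)
    rwa [map_ofNat] at this
  have : CharP k 2 := CharTwo.of_one_ne_zero_of_two_eq_zero one_ne_zero h2k
  have hg : ∀ a : ℤ_[2], g a = 0 ↔ (2 : ℤ_[2]) ∣ a := by
    intro a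
    constructor
    · intro ha
      have hker : RingHom.ker g = IsLocalRing.maximalIdeal ℤ_[2] := by
        apply (IsLocalRing.eq_maximalIdeal ?_)
        have hle : IsLocalRing.maximalIdeal ℤ_[2] ≤ RingHom.ker g := by
          rw [PadicInt.maximalIdeal_eq_span_p, Ideal.span_singleton_le_iff_mem, RingHom.mem_ker]
          rw [map_natCast]; exact_mod_cast h2k
        have hne : RingHom.ker g ≠ ⊤ := RingHom.ker_ne_top g
        rw [← (IsLocalRing.maximalIdeal.isMaximal ℤ_[2]).eq_of_le hne hle]
        exact IsLocalRing.maximalIdeal.isMaximal ℤ_[2]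
      have : a ∈ RingHom.ker g := ha
      rw [hker, PadicInt.maximalIdeal_eq_span_p, Ideal.mem_span_singleton] at this
      simpa using this
    · rintro ⟨c, rfl⟩
      rw [map_mul, map_ofNat, h2k, zero_mul]
  have : Algebra (ZMod 2) k := ZMod.algebra k 2
  have hgz : g = (algebraMap (ZMod 2) k).comp (PadicInt.toZMod) := by
    ext a
    have h1 : (2 : ℤ_[2]) ∣ a - (a.zmodRepr : ℤ_[2]) := by
      have := PadicInt.sub_zmodRepr_mem a
      rw [PadicInt.maximalIdeal_eq_span_p, Ideal.mem_span_singleton] at this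
      simpa using this
    obtain ⟨c, hc⟩ := h1
    have : a = (a.zmodRepr : ℤ_[2]) + 2 * c := by rw [← hc]; ring
    rw [this]
    have h22 : (2 : ZMod 2) = 0 := rfl
    simp only [map_add, map_mul, map_natCast, map_ofNat, h2k, h22, map_zero, zero_mul, RingHom.comp_apply]
  let uA : VR h := ⟨u, hu⟩
  have halg : IsAlgebraic (ZMod 2) (IsLocalRing.residue (VR h) uA) := by
    have h1 : IsAlgebraic ℚ_[2] u := Algebra.IsAlgebraic.isAlgebraic u
    obtain ⟨p, hp0, hp⟩ := h1
    let q := IsLocalization.integerNormalization (nonZeroDivisors ℤ_[2]) p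
    have hq0 : q ≠ 0 := by
      intro hq
      exact hp0 (IsFractionRing.integerNormalization_eq_zero_iff.mp hq)
    let _ : NormalizedGCDMonoid ℤ_[2] := Classical.choice inferInstance
    have hqu : Polynomial.eval₂ (ι F) u q = 0 :=
      IsLocalization.integerNormalization_eval₂_eq_zero (nonZeroDivisors ℤ_[2]) (algebraMap ℚ_[2] F) p hp
    have hqp : Polynomial.eval₂ (ι F) u q.primPart = 0 := by
      rw [q.eq_C_content_mul_primPart, Polynomial.eval₂_mul, Polynomial.eval₂_C] at hqu
      refine (mul_eq_zero.mp hqu).resolve_left ?_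
      rw [← Ne, map_ne_zero_iff _ iota_inj]
      rwa [Ne, Polynomial.content_eq_zero_iff]
    have hA : Polynomial.eval₂ f uA q.primPart = 0 := by
      apply Subtype.val_injective
      have := Polynomial.hom_eval₂ q.primPart f (VR h).subtype uA
      exact this.trans hqp
    refine ⟨q.primPart.map PadicInt.toZMod, ?_, ?_⟩
    · intro hz
      have hd : Polynomial.C (2 : ℤ_[2]) ∣ q.primPart := by
        rw [Polynomial.C_dvd_iff_dvd_coeff]
        intro i
        rw [← hg, hgz, RingHom.comp_apply, ← Polynomial.coeff_map, hz]; simp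
      have hun := q.isPrimitive_primPart 2 hd
      have := PadicInt.prime_p (p := 2)
      exact this.not_isUnit (by simpa using hun)
    · rw [Polynomial.aeval_def, Polynomial.eval₂_map, ← hgz]
      rw [← Polynomial.hom_eval₂, hA, map_zero]
  -- finite subfield
  have hsq : ∃ c : k, c ^ 2 = IsLocalRing.residue (VR h) uA := by
    set x := IsLocalRing.residue (VR h) uA
    let L := IntermediateField.adjoin (ZMod 2) {x}
    have : FiniteDimensional (ZMod 2) L := IntermediateField.adjoin.finiteDimensional halg.isIntegral
    have : Finite L := Module.finite_of_finite (ZMod 2)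
    have : CharP L 2 := charP_of_injective_algebraMap (algebraMap (ZMod 2) L).injective 2
    obtain ⟨c, hc⟩ := surjective_frobenius L 2 ⟨x, IntermediateField.mem_adjoin_simple_self _ x⟩
    refine ⟨c, ?_⟩
    simpa [frobenius_def] using congrArg Subtype.val hc
  obtain ⟨c, hc⟩ := hsq
  obtain ⟨c', rfl⟩ := IsLocalRing.residue_surjective c
  refine ⟨c', ?_⟩
  have := (hres (uA - c' ^ 2)).mp (by rw [map_sub, map_pow, hc, sub_self])
  exact this

end padic
end DGT

namespace DGT

lemma mono {m n : ℤ} {w : WithTop ℤ} (h : (n : WithTop ℤ) ≤ w) (hmn : m ≤ n) :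
    (m : WithTop ℤ) ≤ w := le_trans (by exact_mod_cast hmn) h

lemma coe_le {m n : ℤ} : (m : WithTop ℤ) ≤ (n : WithTop ℤ) ↔ m ≤ n := WithTop.coe_le_coe

end DGT

open DGT in
/-- Let `E/F` be a ramified quadratic extension with odd break `b`, `κ ∈ F* \ (E*)²`,
and suppose `def_F(κ) ≥ δ` with `δ ≥ 0`.  Then
`def_E(κ) ≥ min (2δ + b) (δ + 2 e_F) ≥ b`. -/
theorem defect_growth_threshold
    (F : Type*) [Field F] [Algebra ℚ_[2] F] [FiniteDimensional ℚ_[2] F]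
    (vF : F → WithTop ℤ) (hvF : DiscreteVal F vF)
    (eF : ℤ) (he : vF 2 = (eF : WithTop ℤ))
    (E : Type*) [Field E] [Algebra F E] (hquad : Module.finrank F E = 2)
    (vE : E → WithTop ℤ) (hvE : DiscreteVal E vE)
    (hram : ∀ a : F, vE (algebraMap F E a) = 2 • vF a)
    (s : E ≃ₐ[F] E) (hs : s ≠ 1)
    (πE : E) (hπ : vE πE = 1)
    (b : ℤ) (hbodd : Odd b) (hb : vE (s πE - πE) = ((b + 1 : ℤ) : WithTop ℤ))
    (κ : F) (hκ0 : κ ≠ 0) (hκns : ∀ z : E, z ^ 2 ≠ algebraMap F E κ)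
    (dF dE : ℤ)
    (hdF : HasQuadDefect vF κ (dF : WithTop ℤ))
    (hdE : HasQuadDefect vE (algebraMap F E κ) (dE : WithTop ℤ))
    (δ : ℤ) (hδ0 : 0 ≤ δ) (hδ : δ ≤ dF) :
    min (2 * δ + b) (δ + 2 * eF) ≤ dE ∧ b ≤ min (2 * δ + b) (δ + 2 * eF) := by

  set φ := algebraMap F E with hφ
  have ram_eq : ∀ {a : F} {n : ℤ}, vF a = (n : WithTop ℤ) →
      vE (φ a) = ((2 * n : ℤ) : WithTop ℤ) := by
    intro a n ha
    rw [hram, ha, two_nsmul, ← WithTop.coe_add]; congr 1; ring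
  have ram_ge : ∀ {a : F} {n : ℤ}, (n : WithTop ℤ) ≤ vF a →
      ((2 * n : ℤ) : WithTop ℤ) ≤ vE (φ a) := by
    intro a n ha
    by_cases h0 : a = 0
    · rw [h0, map_zero, hvE.1]; exact le_top
    obtain ⟨m, hm⟩ := exists_int hvF h0
    rw [ram_eq hm, coe_le]
    rw [hm, coe_le] at ha
    omega
  have hπ1 : vE πE = ((1 : ℤ) : WithTop ℤ) := hπ
  have hπ0 : πE ≠ 0 := ne_zero hvE hπ1
  have he1 : 1 ≤ eF := by
    have := two_pos hvF
    rwa [he, coe_le] at this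
  -- valuations of sums
  have hcπ : ∀ {c : F} {n : ℤ}, vF c = (n : WithTop ℤ) →
      vE (φ c * πE) = ((2 * n + 1 : ℤ) : WithTop ℤ) := fun hc => mul_eq hvE (ram_eq hc) hπ1
  have split : ∀ (a c : F) (n : ℤ), (n : WithTop ℤ) ≤ vE (φ a + φ c * πE) →
      (n : WithTop ℤ) ≤ vE (φ a) ∧ (n : WithTop ℤ) ≤ vE (φ c * πE) := by
    intro a c n h
    by_cases ha : a = 0
    · subst ha; simp only [map_zero, zero_add] at h ⊢; exact ⟨by rw [hvE.1]; exact le_top, h⟩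
    by_cases hc : c = 0
    · subst hc; simp only [map_zero, zero_mul, add_zero] at h ⊢
      exact ⟨h, by rw [hvE.1]; exact le_top⟩
    obtain ⟨m, hm⟩ := exists_int hvF ha
    obtain ⟨k, hk⟩ := exists_int hvF hc
    have h1 := ram_eq hm
    have h2 := hcπ hk
    rcases lt_or_gt_of_ne (show 2 * m ≠ 2 * k + 1 by omega) with h3 | h3
    · rw [add_eq hvE h1 (by rw [h2, coe_le]; omega), coe_le] at h
      rw [h1, h2, coe_le, coe_le]; omega
    · rw [add_comm, add_eq hvE h2 (by rw [h1, coe_le]; omega), coe_le] at h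
      rw [h1, h2, coe_le, coe_le]; omega
  have decomp : ∀ x : E, ∃ a c : F, x = φ a + φ c * πE := by
    have hli : LinearIndependent F ![(1 : E), πE] := by
      rw [LinearIndependent.pair_iff]
      intro a c h
      rw [Algebra.smul_def, Algebra.smul_def, mul_one] at h
      have key : ∀ n : ℤ, (n : WithTop ℤ) ≤ vE (φ a + φ c * πE) := by
        intro n; rw [h, hvE.1]; exact le_top
      constructor
      · by_contra h0
        obtain ⟨m, hm⟩ := exists_int hvF h0
        have := (split a c (2 * m + 1) (key _)).1
        rw [ram_eq hm, coe_le] at this; omega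
      · by_contra h0
        obtain ⟨m, hm⟩ := exists_int hvF h0
        have := (split a c (2 * m + 2) (key _)).2
        rw [hcπ hm, coe_le] at this; omega
    have hsp := hli.span_eq_top_of_card_eq_finrank (by simp [hquad])
    intro x
    have hx : x ∈ Submodule.span F (Set.range ![(1 : E), πE]) := by rw [hsp]; trivial
    rw [Matrix.range_cons, Matrix.range_cons, Matrix.range_empty, Set.union_empty,
      Set.singleton_union, Submodule.mem_span_pair] at hx
    obtain ⟨a, c, h⟩ := hx
    exact ⟨a, c, by rw [← h, Algebra.smul_def, Algebra.smul_def, mul_one]⟩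
  obtain ⟨q, p, hqp⟩ := decomp (πE ^ 2)
  have hsne : s πE - πE ≠ 0 := ne_zero hvE hb
  have hsφ : ∀ a : F, s (φ a) = φ a := fun a => s.commutes a
  have hsπ : s πE = φ p - πE := by
    have h1 : (s πE) ^ 2 = φ q + φ p * s πE := by
      have := congrArg s hqp
      simpa [hsφ] using this
    have h2 : (s πE - πE) * (s πE + πE - φ p) = 0 := by linear_combination h1 - hqp
    have := (mul_eq_zero.mp h2).resolve_left hsne
    linear_combination this
  have hN : πE * s πE = φ (-q) := by
    rw [hsπ, map_neg]; linear_combination -hqp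
  have hp1 : ∀ m : ℤ, vF p = (m : WithTop ℤ) → 1 ≤ m := by
    intro m hm
    have h2 := (split q p 2 (by rw [← hqp, pow_eq hvE hπ1]; norm_num)).2
    rw [hcπ hm, coe_le] at h2; omega
  have hbb : 1 ≤ b ∧ b ≤ 2 * eF - 1 := by
    have h2e : vF (-2) = (eF : WithTop ℤ) := by rw [val_neg hvF, he]
    have h1 : s πE - πE = φ p + φ (-2) * πE := by
      rw [hsπ]; simp only [map_neg, map_ofNat]; ring
    have h2 := hcπ h2e
    obtain ⟨j, hj⟩ := hbodd
    by_cases hp : p = 0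
    · rw [h1, hp, map_zero, zero_add, h2] at hb
      have : 2 * eF + 1 = b + 1 := by exact_mod_cast hb
      omega
    obtain ⟨m, hm⟩ := exists_int hvF hp
    have := hp1 m hm
    have h3 := ram_eq hm
    rcases lt_or_gt_of_ne (show 2 * m ≠ 2 * eF + 1 by omega) with h4 | h4
    · rw [h1, add_eq hvE h3 (by rw [h2, coe_le]; omega)] at hb
      have : 2 * m = b + 1 := by exact_mod_cast hb
      omega
    · rw [h1, add_comm, add_eq hvE h2 (by rw [h3, coe_le]; omega)] at hb
      have : 2 * eF + 1 = b + 1 := by exact_mod_cast hb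
      omega
  obtain ⟨hb1, hb2⟩ := hbb
  have sdiff : ∀ (y : E) (n : ℤ), (n : WithTop ℤ) ≤ vE y →
      ((n + b : ℤ) : WithTop ℤ) ≤ vE (s y - y) := by
    intro y n hy
    obtain ⟨a, c, rfl⟩ := decomp y
    have h1 := (split a c n hy).2
    have h2 : s (φ a + φ c * πE) - (φ a + φ c * πE) = φ c * (s πE - πE) := by
      simp only [map_add, map_mul, hsφ]; ring
    rw [h2]
    by_cases hc : c = 0
    · rw [hc, map_zero, zero_mul, hvE.1]; exact le_top
    obtain ⟨m, hm⟩ := exists_int hvF hc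
    rw [hcπ hm, coe_le] at h1
    rw [mul_eq hvE (ram_eq hm) hb, coe_le]; omega
  have hvq : vF (-q) = ((1 : ℤ) : WithTop ℤ) := by
    have h1 : vE (s πE) = ((1 : ℤ) : WithTop ℤ) := by
      have := add_eq hvE (y := s πE - πE) hπ1 (by rw [hb, coe_le]; omega)
      rwa [add_sub_cancel] at this
    have h2 := mul_eq hvE hπ1 h1
    rw [hN] at h2
    have hq0 : -q ≠ 0 := by
      intro h0; rw [h0, map_zero, hvE.1] at h2; exact WithTop.top_ne_coe h2
    obtain ⟨m, hm⟩ := exists_int hvF hq0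
    rw [ram_eq hm] at h2
    have : 2 * m = 1 + 1 := by exact_mod_cast h2
    rw [hm]; congr 1; omega
  have step : ∀ (a : F) (n : ℤ), vF a = (n : WithTop ℤ) → ∃ (y : E) (t : F),
      vE y = (n : WithTop ℤ) ∧ y * s y = φ t ∧ ((n + 1 : ℤ) : WithTop ℤ) ≤ vF (a - t) := by
    intro a n ha
    have hz := zpow_eq hvF hvq n
    have hz0 := ne_zero hvF hz
    have hu := mul_eq hvF ha (inv_eq hvF hz)
    have hu0 : vF (a * ((-q) ^ n)⁻¹) = ((0 : ℤ) : WithTop ℤ) := by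
      rw [hu]; congr 1; ring
    obtain ⟨c, hc⟩ := exists_sqrt hvF hu0.ge
    have hc2 : vF (c ^ 2) = ((0 : ℤ) : WithTop ℤ) := by
      have := add_eq hvF (y := -(a * ((-q) ^ n)⁻¹ - c ^ 2)) hu0 (by rw [val_neg hvF]; exact hc)
      rwa [← sub_eq_add_neg, sub_sub_cancel] at this
    have hc0 : c ≠ 0 := by
      rintro rfl; exact ne_zero hvF hc2 (by simp)
    obtain ⟨m, hm⟩ := exists_int hvF hc0
    have hm0 : m = 0 := by
      rw [pow_eq hvF hm] at hc2
      have : ((2 : ℕ) : ℤ) * m = 0 := by exact_mod_cast hc2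
      omega
    subst hm0
    refine ⟨φ c * πE ^ n, c ^ 2 * (-q) ^ n, ?_, ?_, ?_⟩
    · rw [mul_eq hvE (ram_eq hm) (zpow_eq hvE hπ1 n)]; congr 1; ring
    · rw [map_mul s, map_zpow₀ s, hsφ, map_mul φ, map_zpow₀ φ, ← hN, mul_zpow, map_pow]; ring
    · have : a - c ^ 2 * (-q) ^ n = (a * ((-q) ^ n)⁻¹ - c ^ 2) * (-q) ^ n := by
        field_simp
      rw [this]
      exact mono (mul_ge hvF hc hz.ge) (by omega)
  have h2E : vE 2 = ((2 * eF : ℤ) : WithTop ℤ) := by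
    have := ram_eq he
    rwa [map_ofNat] at this
  have approx : ∀ (d T : ℤ), 0 ≤ d → T ≤ 2 * d + b → T ≤ d + 2 * eF → ∀ (j : ℕ) (n : ℤ),
      T ≤ 2 * (n + j) → d ≤ n → ∀ a : F, (n : WithTop ℤ) ≤ vF a →
      ∃ y : E, (n : WithTop ℤ) ≤ vE y ∧ (T : WithTop ℤ) ≤ vE (φ a - y ^ 2) := by
    intro d T hd hT1 hT2 j
    induction j with
    | zero =>
      intro n hn hdn a ha
      refine ⟨0, by rw [hvE.1]; exact le_top, ?_⟩
      have := ram_ge ha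
      simp only [ne_eq, OfNat.ofNat_ne_zero, not_false_eq_true, zero_pow, sub_zero]
      exact mono this (by push_cast at hn; omega)
    | succ j ih =>
      intro n hn hdn a ha
      push_cast at hn
      rcases ha.eq_or_lt with h1 | h1
      · obtain ⟨y0, t, hy0, hyt, hat⟩ := step a n h1.symm
        obtain ⟨y1, hy1, hy1'⟩ := ih (n + 1) (by omega) (by omega) _ hat
        refine ⟨y0 + y1, add_ge hvE hy0.ge (mono hy1 (by omega)), ?_⟩
        have e1 : φ a - (y0 + y1) ^ 2 =
            (φ (a - t) - y1 ^ 2) + (y0 * (s y0 - y0) - 2 * (y0 * y1)) := by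
          rw [map_sub, ← hyt]; ring
        rw [e1]
        refine add_ge hvE hy1' (sub_ge hvE ?_ ?_)
        · exact mono (mul_ge hvE hy0.ge (sdiff y0 n hy0.ge)) (by omega)
        · exact mono (mul_ge hvE h2E.ge (mul_ge hvE hy0.ge hy1)) (by omega)
      · obtain ⟨y, hy, hy'⟩ := ih (n + 1) (by omega) (by omega) a (coe_le_of_lt h1)
        exact ⟨y, mono hy (by omega), hy'⟩
  have main : ∀ (d T : ℤ), 1 ≤ d → T ≤ 2 * d + b → T ≤ d + 2 * eF → ∀ a : F,
      (d : WithTop ℤ) ≤ vF a → ∃ w : E, (T : WithTop ℤ) ≤ vE (w ^ 2 * φ (1 + a) - 1) := by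
    intro d T hd hT1 hT2 a ha
    obtain ⟨y, hy, hy'⟩ := approx d T (by omega) hT1 hT2 T.natAbs d (by omega) le_rfl a ha
    have h1y : vE (1 + y) = ((0 : ℤ) : WithTop ℤ) :=
      add_eq hvE (val_one hvE) (mono hy (by omega))
    have h0 := ne_zero hvE h1y
    refine ⟨(1 + y)⁻¹, ?_⟩
    have e1 : ((1 + y)⁻¹) ^ 2 * φ (1 + a) - 1
        = ((φ a - y ^ 2) - 2 * y) * ((1 + y)⁻¹) ^ 2 := by
      rw [map_add, map_one]; field_simp; ring
    rw [e1]
    have h2 : (T : WithTop ℤ) ≤ vE ((φ a - y ^ 2) - 2 * y) :=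
      sub_ge hvE hy' (mono (mul_ge hvE h2E.ge hy) (by omega))
    exact mono (mul_ge hvE h2 (pow_eq hvE (inv_eq hvE h1y) 2).ge) (by push_cast; omega)
  have fin : ∀ (T : ℤ) (K : E), (T : WithTop ℤ) ≤ vE (K ^ 2 * φ κ - 1) → T ≤ dE := by
    intro T K hK
    have := hK.trans (hdE.2 ⟨K, rfl⟩)
    exact coe_le.mp this
  refine ⟨?_, by rw [le_min_iff]; omega⟩
  rcases hδ0.eq_or_lt with h0 | h0
  · subst h0
    refine le_trans (b := b) (min_le_of_left_le (by omega)) ?_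
    obtain ⟨n, hn⟩ := exists_int hvF hκ0
    obtain ⟨y, t, hy, hyt, ht⟩ := step κ n hn
    have hvt : vF t = (n : WithTop ℤ) := by
      have := add_eq hvF (y := -(κ - t)) hn (by rw [val_neg hvF]; exact ht)
      rwa [← sub_eq_add_neg, sub_sub_cancel] at this
    have ht0 := ne_zero hvF hvt
    have hy0 := ne_zero hvE hy
    obtain ⟨w, hw⟩ := main 1 b le_rfl (by omega) (by omega) ((κ - t) * t⁻¹)
      (mono (mul_ge hvF ht (inv_eq hvF hvt).ge) (by omega))
    have hη : (b : WithTop ℤ) ≤ vE ((s y - y) * y⁻¹) :=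
      mono (mul_ge hvE (sdiff y n hy.ge) (inv_eq hvE hy).ge) (by omega)
    apply fin b (w * y⁻¹)
    have e2 : φ κ = φ (1 + (κ - t) * t⁻¹) * (y * s y) := by
      rw [hyt, ← map_mul]; congr 1; field_simp; ring
    have e1 : (w * y⁻¹) ^ 2 * φ κ - 1 = (w ^ 2 * φ (1 + (κ - t) * t⁻¹) - 1) *
        (1 + (s y - y) * y⁻¹) + (s y - y) * y⁻¹ := by
      rw [e2]; field_simp; ring
    rw [e1]
    refine add_ge hvE (mono (mul_ge hvE hw (n := 0) ?_) (by omega)) hη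
    exact add_ge hvE (val_one hvE).ge (mono hη (by omega))
  · obtain ⟨k, hk⟩ := hdF.1
    obtain ⟨w, hw⟩ := main δ (min (2 * δ + b) (δ + 2 * eF)) (by omega) (min_le_left _ _)
      (min_le_right _ _) (k ^ 2 * κ - 1) (by rw [hk, coe_le]; exact hδ)
    apply fin _ (w * φ k)
    have : (w * φ k) ^ 2 * φ κ = w ^ 2 * φ (1 + (k ^ 2 * κ - 1)) := by
      rw [add_sub_cancel, map_mul, map_pow]; ring
    rw [this]; exact hw
end

section
/- Let F be a 2-adic field, β ∈ F with v_F(β) = 2e_F − b, 0 < b < 2e_F, b odd. If κ ∈ 1 + 𝔓_F has quadratic defect def_F(κ) = 2e_F − a with 0 < a ≤ b, then there exist μ ∈ 𝒪_F with v_F(μ) = (b − a)/2 and λ ∈ 𝒪_{T_F} (either 0 or with z² + z = λ irreducible over the maximal unramified subfield T_F) such that κ ≡ (1 + μ²β)(1 + 4λ) modulo (1 + 𝔓_F)². -/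
namespace OneUnit
set_option linter.unusedSectionVars false
set_option linter.unusedVariables false
open Polynomial

section basic
variable {F : Type*} [Field F] {v : F → WithTop ℤ}

theorem v_one (hv : DiscreteVal F v) : v 1 = 0 := by
  have h := hv.2.2.1 1 1
  rw [mul_one] at h
  have h1 : v 1 ≠ ⊤ := fun h => one_ne_zero (hv.2.1 1 h)
  lift v 1 to ℤ using h1 with n
  norm_cast at h ⊢
  omega

theorem v_int (hv : DiscreteVal F v) {x : F} (hx : x ≠ 0) : ∃ n : ℤ, v x = n := by
  have h1 : v x ≠ ⊤ := fun h => hx (hv.2.1 x h)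
  lift v x to ℤ using h1 with n
  exact ⟨n, rfl⟩

theorem v_neg_one (hv : DiscreteVal F v) : v (-1) = 0 := by
  have h := hv.2.2.1 (-1) (-1)
  rw [neg_mul_neg, one_mul, v_one hv] at h
  obtain ⟨n, hn⟩ := v_int hv (x := -1) (by simp)
  rw [hn] at h ⊢
  norm_cast at h ⊢
  omega

theorem v_neg (hv : DiscreteVal F v) (x : F) : v (-x) = v x := by
  rw [← neg_one_mul, hv.2.2.1, v_neg_one hv, zero_add]

theorem ge_mul (hv : DiscreteVal F v) {x y : F} {m n : ℤ} (hx : (m : WithTop ℤ) ≤ v x)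
    (hy : (n : WithTop ℤ) ≤ v y) : ((m + n : ℤ) : WithTop ℤ) ≤ v (x * y) := by
  rw [hv.2.2.1]; push_cast; exact add_le_add hx hy

theorem ge_add (hv : DiscreteVal F v) {x y : F} {n : ℤ} (hx : (n : WithTop ℤ) ≤ v x)
    (hy : (n : WithTop ℤ) ≤ v y) : (n : WithTop ℤ) ≤ v (x + y) :=
  le_trans (le_min hx hy) (hv.2.2.2.1 x y)

theorem ge_neg (hv : DiscreteVal F v) {x : F} {n : ℤ} (hx : (n : WithTop ℤ) ≤ v x) :
    (n : WithTop ℤ) ≤ v (-x) := by rwa [v_neg hv]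

theorem ge_sub (hv : DiscreteVal F v) {x y : F} {n : ℤ} (hx : (n : WithTop ℤ) ≤ v x)
    (hy : (n : WithTop ℤ) ≤ v y) : (n : WithTop ℤ) ≤ v (x - y) := by
  rw [sub_eq_add_neg]; exact ge_add hv hx (ge_neg hv hy)

theorem ge_sq (hv : DiscreteVal F v) {x : F} {m : ℤ} (hx : (m : WithTop ℤ) ≤ v x) :
    ((m + m : ℤ) : WithTop ℤ) ≤ v (x ^ 2) := by
  rw [sq]; exact ge_mul hv hx hx

theorem ge_mono {x : F} {m n : ℤ} (hx : (m : WithTop ℤ) ≤ v x) (h : n ≤ m) :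
    (n : WithTop ℤ) ≤ v x := le_trans (by exact_mod_cast h) hx

theorem pos_iff (hv : DiscreteVal F v) {x : F} : 0 < v x ↔ ((1 : ℤ) : WithTop ℤ) ≤ v x := by
  by_cases hx : x = 0
  · rw [hx, hv.1]; simp
  · obtain ⟨n, hn⟩ := v_int hv hx
    rw [hn]; norm_cast

theorem v_inv (hv : DiscreteVal F v) {x : F} {n : ℤ} (hx : v x = n) : v x⁻¹ = (-n : ℤ) := by
  have h0 : x ≠ 0 := by
    rintro rfl
    rw [hv.1] at hx; exact absurd hx (by simp)
  obtain ⟨m, hm⟩ := v_int hv (inv_ne_zero h0)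
  have := hv.2.2.1 x x⁻¹
  rw [mul_inv_cancel₀ h0, v_one hv, hx, hm] at this
  rw [hm]
  norm_cast at this ⊢
  omega

theorem v_pow (hv : DiscreteVal F v) {x : F} {n : ℤ} (hx : v x = n) (k : ℕ) :
    v (x ^ k) = (k * n : ℤ) := by
  induction k with
  | zero => simpa using v_one hv
  | succ k ih => rw [pow_succ, hv.2.2.1, ih, hx]; norm_cast; push_cast; ring

theorem v_zpow (hv : DiscreteVal F v) {x : F} (hx : v x = 1) (k : ℤ) :
    v (x ^ k) = (k : ℤ) := by
  have hx' : v x = ((1 : ℤ) : WithTop ℤ) := by simpa using hx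
  cases k with
  | ofNat k => simpa using v_pow hv hx' k
  | negSucc k =>
    rw [zpow_negSucc, v_inv hv (v_pow hv hx' (k+1))]
    congr 1; push_cast; rw [Int.negSucc_eq]; ring

/-- dominance -/
theorem v_add_eq (hv : DiscreteVal F v) {x y : F} {n : ℤ} (hx : v x = n)
    (hy : ((n + 1 : ℤ) : WithTop ℤ) ≤ v y) : v (x + y) = n := by
  apply le_antisymm
  · by_contra hc
    rw [not_le] at hc
    have h1 : ((n + 1 : ℤ) : WithTop ℤ) ≤ v (x + y) := by
      by_cases h0 : x + y = 0
      · rw [h0, hv.1]; simp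
      · obtain ⟨m, hm⟩ := v_int hv h0
        rw [hm] at hc ⊢
        norm_cast at hc ⊢
    have := ge_sub hv h1 hy
    rw [add_sub_cancel_right, hx] at this
    norm_cast at this
    omega
  · exact ge_add hv hx.ge (ge_mono hy (by omega))

end basic

section padic
variable {F : Type*} [Field F] [Algebra ℚ_[2] F] {v : F → WithTop ℤ}

theorem exists_root_padic (n : ℕ) (hn : Odd n) (x : ℤ_[2]) : ∃ y : ℤ_[2], y ^ n = 1 + 2 * x := by
  have h2 : ‖(2 : ℤ_[2])‖ < 1 := by
    have := PadicInt.norm_p (p := 2)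
    have h3 : ‖(2 : ℤ_[2])‖ = 2⁻¹ := by simpa using this
    rw [h3]; norm_num
  have hnu : ‖(n : ℤ_[2])‖ = 1 := by
    rw [← PadicInt.isUnit_iff]
    obtain ⟨k, rfl⟩ := hn
    by_contra hu
    rw [PadicInt.not_isUnit_iff] at hu
    have : ‖(((2 * k + 1 : ℕ) : ℤ_[2])) + -(2 * k)‖ < 1 := by
      refine lt_of_le_of_lt (PadicInt.nonarchimedean _ (-(2 * k))) ?_
      rw [norm_neg, norm_mul]
      exact max_lt hu (lt_of_le_of_lt (mul_le_of_le_one_right (norm_nonneg _) (PadicInt.norm_le_one _)) h2)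
    push_cast at this
    simp at this
  obtain ⟨z, hz, -⟩ := hensels_lemma (p := 2) (F := (X ^ n - C (1 + 2 * x) : ℤ_[2][X])) (a := 1) (by
    simp [hnu, derivative_X_pow]
    exact lt_of_le_of_lt (mul_le_of_le_one_right (norm_nonneg _) (PadicInt.norm_le_one _)) h2)
  refine ⟨z, ?_⟩
  simp at hz
  linear_combination hz

theorem v_padicInt (hv : DiscreteVal F v) {e : ℤ} (he : v 2 = e) (he0 : 0 < e) (x : ℤ_[2]) :
    ((0 : ℤ) : WithTop ℤ) ≤ v (algebraMap ℚ_[2] F x) := by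
  by_cases hx : (algebraMap ℚ_[2] F x) = 0
  · rw [hx, hv.1]; simp
  obtain ⟨m, hm⟩ := v_int hv hx
  rw [hm]
  norm_cast
  by_contra hm0
  push Not at hm0
  lift e to ℕ using he0.le
  obtain ⟨y, hy⟩ := exists_root_padic (2 * e + 1) ⟨e, rfl⟩ (x ^ (2 * e + 1))
  have hy' := congrArg (fun z : ℤ_[2] => algebraMap ℚ_[2] F (z : ℚ_[2])) hy
  simp only [PadicInt.coe_pow, PadicInt.coe_add, PadicInt.coe_mul, map_pow, map_add, map_mul, PadicInt.coe_one, map_one] at hy'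
  have h2 : algebraMap ℚ_[2] F ((2 : ℤ_[2]) : ℚ_[2]) = 2 := by
    have : ((2 : ℤ_[2]) : ℚ_[2]) = 2 := by norm_cast
    rw [this, map_ofNat]
  rw [h2] at hy'
  have hr : v (2 * (algebraMap ℚ_[2] F x) ^ (2 * e + 1)) = ((e + (2 * e + 1 : ℕ) * m : ℤ) : WithTop ℤ) := by
    rw [hv.2.2.1, he, v_pow hv hm]; norm_cast
  have hr2 := v_add_eq hv (y := 1) hr (by
    rw [v_one hv]; norm_cast; push_cast; nlinarith)
  rw [add_comm, ← hy'] at hr2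
  have hy0 : (algebraMap ℚ_[2] F y) ≠ 0 := by
    intro h
    rw [h, zero_pow (by omega), hv.1] at hr2
    exact absurd hr2 WithTop.top_ne_coe
  obtain ⟨k, hk⟩ := v_int hv hy0
  rw [v_pow hv hk] at hr2
  norm_cast at hr2
  push_cast at hr2
  have : (2 * (e : ℤ) + 1) ∣ e := ⟨k - m, by linear_combination - hr2⟩
  have := Int.le_of_dvd he0 this
  omega

/-- valuation ring -/
def vring (hv : DiscreteVal F v) : ValuationSubring F where
  carrier := {x | ((0 : ℤ) : WithTop ℤ) ≤ v x}
  mul_mem' := fun ha hb => by simpa using ge_mul hv ha hb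
  one_mem' := by simp [v_one hv]
  add_mem' := fun ha hb => ge_add hv ha hb
  zero_mem' := by simp [hv.1]
  neg_mem' := fun ha => ge_neg hv ha
  mem_or_inv_mem' := fun x => by
    by_cases hx : x = 0
    · left; simp [hx, hv.1]
    · obtain ⟨n, hn⟩ := v_int hv hx
      simp only [Set.mem_ofPred_eq, v_inv hv hn, hn]
      norm_cast
      omega

theorem mem_vring (hv : DiscreteVal F v) (x : F) : x ∈ vring hv ↔ ((0 : ℤ) : WithTop ℤ) ≤ v x := Iff.rfl

/-- the structure map of the valuation ring -/
noncomputable def zmap (hv : DiscreteVal F v) {e : ℤ} (he : v 2 = e) (he0 : 0 < e) : ℤ_[2] →+* vring hv :=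
  ((algebraMap ℚ_[2] F).comp (PadicInt.Coe.ringHom)).codRestrict (vring hv)
    (fun x => v_padicInt hv he he0 x)

theorem ge_of_spectral [FiniteDimensional ℚ_[2] F] (hv : DiscreteVal F v) {e : ℤ} (he : v 2 = e)
    (he0 : 0 < e) (x : F) (hx : spectralNorm ℚ_[2] F x ≤ 1) :
    ∃ p : ℤ_[2][X], p.Monic ∧ p.eval₂ ((algebraMap ℚ_[2] F).comp (PadicInt.Coe.ringHom)) x = 0 := by
  have hxint : IsIntegral ℚ_[2] x := Algebra.IsIntegral.isIntegral x
  have hm := minpoly.monic hxint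
  have hc := (spectralValue_le_one_iff hm).1 hx
  have hl : minpoly ℚ_[2] x ∈ lifts (PadicInt.Coe.ringHom (p := 2)) := by
    rw [lifts_iff_coeff_lifts]
    intro n
    exact ⟨⟨_, hc n⟩, rfl⟩
  obtain ⟨q, hq, -, hqm⟩ := lifts_and_natDegree_eq_and_monic hl hm
  refine ⟨q, hqm, ?_⟩
  rw [← eval₂_map, hq]
  exact minpoly.aeval _ _

theorem vring_of_integral (hv : DiscreteVal F v) {e : ℤ} (he : v 2 = e)
    (he0 : 0 < e) (x : F) (p : ℤ_[2][X]) (hp : p.Monic)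
    (h : p.eval₂ ((algebraMap ℚ_[2] F).comp (PadicInt.Coe.ringHom)) x = 0) :
    ((0 : ℤ) : WithTop ℤ) ≤ v x := by
  have : IsIntegral (vring hv) x := by
    refine ⟨p.map (zmap hv he he0), hp.map _, ?_⟩
    rw [eval₂_map]
    exact h
  obtain ⟨y, hy⟩ := IsIntegrallyClosed.algebraMap_eq_of_integral this
  rw [← hy]
  exact y.2

theorem spectral_two : spectralNorm ℚ_[2] F 2 = 1 / 2 := by
  have := spectralNorm_extends (K := ℚ_[2]) (L := F) 2
  rw [map_ofNat] at this
  rw [this]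
  have := Padic.norm_p (p := 2)
  simpa using this

theorem spectral_iff [FiniteDimensional ℚ_[2] F] (hv : DiscreteVal F v) {e : ℤ} (he : v 2 = e)
    (he0 : 0 < e) (x : F) : spectralNorm ℚ_[2] F x ≤ 1 ↔ ((0 : ℤ) : WithTop ℤ) ≤ v x := by
  constructor
  · intro h
    obtain ⟨p, hp, hp2⟩ := ge_of_spectral hv he he0 x h
    exact vring_of_integral hv he he0 x p hp hp2
  · intro h
    by_contra hc
    push Not at hc
    let := spectralNorm.normedField ℚ_[2] F
    have hc' : 1 < ‖x‖ := hc
    have hx0 : x ≠ 0 := by rintro rfl; simp at hc'; linarith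
    obtain ⟨n, hn⟩ := pow_unbounded_of_one_lt 2 hc'
    have h2 : ‖(2 : F)‖ = 1 / 2 := spectral_two
    have h3 : ‖(x ^ n)⁻¹ * 2⁻¹‖ ≤ 1 := by
      rw [norm_mul, norm_inv, norm_inv, norm_pow, h2]
      rw [one_div, inv_inv, inv_mul_le_iff₀ (by positivity)]
      linarith
    obtain ⟨p, hp, hp2⟩ := ge_of_spectral hv he he0 _ h3
    have h4 := vring_of_integral hv he he0 _ p hp hp2
    obtain ⟨m, hm⟩ := v_int hv hx0
    rw [hv.2.2.1, v_inv hv (v_pow hv hm n), v_inv hv he] at h4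
    rw [hm] at h
    norm_cast at h h4
    have : 0 ≤ (n : ℤ) * m := by positivity
    omega

theorem root_of_norm {L : Type*} [NormedField L] [CompleteSpace L] (hna : ∀ x y : L, ‖x + y‖ ≤ max ‖x‖ ‖y‖)
    (y : L) (hy : ‖y‖ < 1) : ∃ z : L, z ^ 2 + z = y := by
  let f : ℕ → L := fun n => Nat.rec 0 (fun _ z => y - z ^ 2) n
  have hf : ∀ n, f (n + 1) = y - f n ^ 2 := fun n => rfl
  have hb : ∀ n, ‖f n‖ ≤ ‖y‖ := by
    intro n
    induction n with
    | zero => simp [f]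
    | succ n ih =>
      rw [hf, sub_eq_add_neg]
      refine (hna _ _).trans (max_le le_rfl ?_)
      rw [norm_neg, norm_pow]
      nlinarith [norm_nonneg (f n)]
  have hd : ∀ n, dist (f n) (f (n + 1)) ≤ 1 * ‖y‖ ^ n := by
    intro n
    induction n with
    | zero => simp [f]; exact hy.le
    | succ n ih =>
      have : f (n + 1) - f (n + 2) = - ((f n - f (n + 1)) * (f n + f (n + 1))) := by
        rw [hf (n + 1)]; nth_rewrite 1 [hf n]; ring
      rw [dist_eq_norm] at ih ⊢
      rw [this, norm_neg, norm_mul, pow_succ, ← mul_assoc]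
      exact mul_le_mul ih ((hna _ _).trans (max_le (hb n) (hb (n + 1)))) (norm_nonneg _) (by positivity)
  obtain ⟨z, hz⟩ := cauchySeq_tendsto_of_complete (cauchySeq_of_le_geometric ‖y‖ 1 hy hd)
  have h1 : Filter.Tendsto (fun n => f (n + 1)) Filter.atTop (nhds z) := hz.comp (Filter.tendsto_add_atTop_nat 1)
  have h2 : Filter.Tendsto (fun n => f (n + 1)) Filter.atTop (nhds (y - z ^ 2)) := by
    simp only [hf]
    exact tendsto_const_nhds.sub (hz.pow 2)
  have := tendsto_nhds_unique h1 h2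
  exact ⟨z, by linear_combination this⟩

theorem exists_root [FiniteDimensional ℚ_[2] F] (hv : DiscreteVal F v) {e : ℤ} (he : v 2 = e)
    (he0 : 0 < e) (y : F) (hy : ((1 : ℤ) : WithTop ℤ) ≤ v y) : ∃ z : F, z ^ 2 + z = y := by
  by_cases hy0 : y = 0
  · exact ⟨0, by simp [hy0]⟩
  let := spectralNorm.normedField ℚ_[2] F
  have : CompleteSpace F := spectralNorm.completeSpace ℚ_[2] F
  refine root_of_norm (fun x y => isNonarchimedean_spectralNorm x y) y ?_
  by_contra hc
  push Not at hc
  have h1 : ‖y⁻¹‖ ≤ 1 := by rw [norm_inv]; exact inv_le_one_of_one_le₀ hc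
  have h2 := (spectral_iff hv he he0 _).1 h1
  obtain ⟨m, hm⟩ := v_int hv hy0
  rw [v_inv hv hm] at h2
  rw [hm] at hy
  norm_cast at hy h2
  omega

theorem residue_zero_iff (hv : DiscreteVal F v) (x : vring hv) :
    IsLocalRing.residue (vring hv) x = 0 ↔ ((1 : ℤ) : WithTop ℤ) ≤ v x := by
  rw [IsLocalRing.residue_eq_zero_iff, IsLocalRing.mem_maximalIdeal, mem_nonunits_iff]
  by_cases hx : (x : F) = 0
  · rw [hx, hv.1]
    have : x = 0 := Subtype.ext hx
    simp [this]
  obtain ⟨m, hm⟩ := v_int hv hx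
  have hx2 := x.2
  rw [mem_vring, hm] at hx2
  rw [hm]
  norm_cast at hx2 ⊢
  constructor
  · intro h
    by_contra hc
    have hm0 : m = 0 := by omega
    apply h
    refine IsUnit.of_mul_eq_one ⟨(x : F)⁻¹, ?_⟩ ?_
    · rw [mem_vring, v_inv hv hm, hm0]; simp
    · apply Subtype.ext
      simp [hx]
  · intro h hu
    obtain ⟨w, hw⟩ := hu.exists_right_inv
    have hw' : (x : F) * (w : F) = 1 := congrArg Subtype.val hw
    have h3 := ge_mul hv hm.ge w.2
    rw [hw', v_one hv] at h3
    norm_cast at h3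
    omega

theorem exists_sqrt_mod [FiniteDimensional ℚ_[2] F] (hv : DiscreteVal F v) {e : ℤ} (he : v 2 = e)
    (he0 : 0 < e) (x : F) (hx : ((0 : ℤ) : WithTop ℤ) ≤ v x) :
    ∃ w : F, ((0 : ℤ) : WithTop ℤ) ≤ v w ∧ ((1 : ℤ) : WithTop ℤ) ≤ v (x - w ^ 2) := by
  let k := IsLocalRing.ResidueField (vring hv)
  have h20 : (2 : k) = 0 := by
    have h := (residue_zero_iff hv (2 : vring hv)).2 (by
      have : ((2 : vring hv) : F) = 2 := rfl
      rw [this, he]; norm_cast)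
    rw [map_ofNat] at h
    exact h
  have : CharP k 2 := CharTwo.of_one_ne_zero_of_two_eq_zero one_ne_zero h20
  let : Algebra (ZMod 2) k := ZMod.algebra k 2
  let g : ℤ_[2] →+* k := (IsLocalRing.residue (vring hv)).comp (zmap hv he he0)
  have hg : g = (algebraMap (ZMod 2) k).comp PadicInt.toZMod := by
    ext z
    have hz := PadicInt.toZMod_spec z
    rw [PadicInt.maximalIdeal_eq_span_p, Ideal.mem_span_singleton] at hz
    obtain ⟨c, hc⟩ := hz
    have h1 : g z - g (ZMod.cast (PadicInt.toZMod z) : ℤ_[2]) = 0 := by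
      have hg2 : g ((2 : ℕ) : ℤ_[2]) = 0 := by
        rw [map_natCast]; exact_mod_cast h20
      rw [← map_sub, hc, map_mul, hg2, zero_mul]
    rw [sub_eq_zero.1 h1]
    simp only [RingHom.comp_apply]
    generalize PadicInt.toZMod z = t
    fin_cases t
    · change g (ZMod.cast (0 : ZMod 2) : ℤ_[2]) = algebraMap (ZMod 2) k 0
      rw [ZMod.cast_zero, map_zero, map_zero]
    · have : (ZMod.cast (1 : ZMod 2) : ℤ_[2]) = 1 := by
        simp [ZMod.cast_eq_val, ZMod.val_one]
      change g (ZMod.cast (1 : ZMod 2) : ℤ_[2]) = algebraMap (ZMod 2) k 1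
      rw [this, map_one, map_one]
  have : Algebra.IsAlgebraic (ZMod 2) k := by
    refine ⟨fun r => ?_⟩
    obtain ⟨y, rfl⟩ := IsLocalRing.residue_surjective r
    obtain ⟨p, hp, hp2⟩ := ge_of_spectral hv he he0 y ((spectral_iff hv he he0 _).2 y.2)
    have h3 : p.eval₂ (zmap hv he he0) y = 0 := by
      apply Subtype.ext
      have := hom_eval₂ p (zmap hv he he0) (vring hv).subtype y
      exact this.trans hp2
    have h4 : p.eval₂ g (IsLocalRing.residue (vring hv) y) = 0 := by
      rw [← hom_eval₂, h3, map_zero]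
    refine ⟨p.map PadicInt.toZMod, (hp.map _).ne_zero, ?_⟩
    rw [aeval_def, eval₂_map, ← hg, h4]
  have : PerfectField k := Algebra.IsAlgebraic.perfectField (ZMod 2)
  have : Fact (Nat.Prime 2) := ⟨Nat.prime_two⟩
  have : ExpChar k 2 := ExpChar.prime Nat.prime_two
  have : PerfectRing k 2 := PerfectField.toPerfectRing 2
  obtain ⟨r, hr⟩ := (PerfectRing.bijective_frobenius (R := k) (p := 2)).2
    (IsLocalRing.residue (vring hv) ⟨x, hx⟩)
  obtain ⟨w, rfl⟩ := IsLocalRing.residue_surjective r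
  refine ⟨w, w.2, ?_⟩
  have hr : (IsLocalRing.residue (vring hv) w) ^ 2 = IsLocalRing.residue (vring hv) ⟨x, hx⟩ := hr
  exact (residue_zero_iff hv (⟨x, hx⟩ - w ^ 2)).1 (by rw [map_sub, map_pow, hr, sub_self])

theorem exists_sqrt_step [FiniteDimensional ℚ_[2] F] (hv : DiscreteVal F v) {e : ℤ} (he : v 2 = e)
    (he0 : 0 < e) (x : F) (n : ℤ) (hx : ((n + n : ℤ) : WithTop ℤ) ≤ v x) :
    ∃ w : F, (n : WithTop ℤ) ≤ v w ∧ ((n + n + 1 : ℤ) : WithTop ℤ) ≤ v (x - w ^ 2) := by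
  obtain ⟨π, hπ⟩ := hv.2.2.2.2
  have hπ0 : π ≠ 0 := by
    rintro rfl
    rw [hv.1] at hπ; exact absurd hπ (by decide)
  have h1 := ge_mul hv hx (v_zpow hv hπ (-n + -n)).ge
  obtain ⟨w, hw, hw2⟩ := exists_sqrt_mod hv he he0 _ (ge_mono h1 (by omega))
  refine ⟨w * π ^ n, ge_mono (ge_mul hv hw (v_zpow hv hπ n).ge) (by omega), ?_⟩
  have h2 := ge_mul hv hw2 (v_zpow hv hπ (n + n)).ge
  have h3 : (x * π ^ (-n + -n) - w ^ 2) * π ^ (n + n) = x - (w * π ^ n) ^ 2 := by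
    rw [zpow_add₀ hπ0, zpow_add₀ hπ0, zpow_neg]
    field_simp
  rw [h3] at h2
  exact ge_mono h2 (by omega)

end padic

section main
variable {F : Type*} [Field F] [Algebra ℚ_[2] F] [FiniteDimensional ℚ_[2] F] {v : F → WithTop ℤ}

theorem approx (hv : DiscreteVal F v) {e : ℤ} (he : v 2 = e) (he0 : 0 < e)
    {β : F} {a b m : ℤ} (hβ : v β = (2 * e - b : ℤ)) (hbodd : Odd b) (hb2 : b < 2 * e)
    (hm : b - a = 2 * m) (ha0 : 0 < a) (hm0 : 0 ≤ m) {κ : F} (hκ : v (κ - 1) = (2 * e - a : ℤ)) (j : ℕ)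
    (hj : 2 * e - a + 1 + j ≤ 2 * e) :
    ∃ μ t : F, v μ = (m : WithTop ℤ) ∧ ((1 : ℤ) : WithTop ℤ) ≤ v (t - 1) ∧
      ((2 * e - a + 1 + j : ℤ) : WithTop ℤ) ≤ v (κ - (1 + μ ^ 2 * β) * t ^ 2) := by
  have hβ0 : β ≠ 0 := by
    rintro rfl
    rw [hv.1] at hβ
    exact absurd hβ WithTop.top_ne_coe
  induction j with
  | zero =>
    have h1 : v ((κ - 1) * β⁻¹) = ((m + m : ℤ) : WithTop ℤ) := by
      rw [hv.2.2.1, hκ, v_inv hv hβ, ← WithTop.coe_add]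
      congr 1; omega
    obtain ⟨w, hw, hw2⟩ := exists_sqrt_step hv he he0 _ m h1.ge
    refine ⟨w, 1, ?_, ?_, ?_⟩
    · have h2 := v_add_eq hv h1 (ge_neg hv hw2)
      rw [neg_sub, add_sub_cancel] at h2
      have hw0 : w ≠ 0 := by
        rintro rfl
        rw [zero_pow two_ne_zero, hv.1] at h2
        exact absurd h2 WithTop.top_ne_coe
      obtain ⟨n, hn⟩ := v_int hv hw0
      rw [v_pow hv hn 2] at h2
      rw [hn]
      have h2' := WithTop.coe_injective h2
      congr 1
      push_cast at h2'
      omega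
    · rw [sub_self, hv.1]; exact le_top
    · have h3 := ge_mul hv hw2 hβ.ge
      have h4 : ((κ - 1) * β⁻¹ - w ^ 2) * β = κ - (1 + w ^ 2 * β) * 1 ^ 2 := by
        field_simp
        ring
      rw [h4] at h3
      exact ge_mono h3 (by push_cast; omega)
  | succ j ih =>
    obtain ⟨μ, t, hμ, ht, hε⟩ := ih (by push_cast at hj; omega)
    push_cast at hj
    generalize hn : 2 * e - a + 1 + (j : ℤ) = n at hε hj
    have hgoal : 2 * e - a + 1 + ((j + 1 : ℕ) : ℤ) = n + 1 := by push_cast; omega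
    rw [hgoal]
    have hμβ : ((2 * e - a : ℤ) : WithTop ℤ) ≤ v (μ ^ 2 * β) :=
      ge_mono (ge_mul hv (ge_sq hv hμ.ge) hβ.ge) (by omega)
    have ht0 : ((0 : ℤ) : WithTop ℤ) ≤ v t := by
      have h1 := ge_add hv (ge_mono ht (by omega : (0:ℤ) ≤ 1)) (y := 1) (by rw [v_one hv]; rfl)
      rwa [sub_add_cancel] at h1
    have h1v : ((0 : ℤ) : WithTop ℤ) ≤ v 1 := by rw [v_one hv]; rfl
    rcases Int.even_or_odd n with ⟨s, hs⟩ | ⟨s, hs⟩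
    · obtain ⟨w, hw, hw2⟩ := exists_sqrt_step hv he he0 _ s (ge_mono hε hs.ge)
      refine ⟨μ, t + w, hμ, ?_, ?_⟩
      · have : t + w - 1 = (t - 1) + w := by ring
        rw [this]
        exact ge_add hv ht (ge_mono hw (by omega))
      · have : κ - (1 + μ ^ 2 * β) * (t + w) ^ 2 =
          ((κ - (1 + μ ^ 2 * β) * t ^ 2 - w ^ 2) - (μ ^ 2 * β) * w ^ 2) -
            (1 + μ ^ 2 * β) * (2 * (t * w)) := by ring
        rw [this]
        refine ge_sub hv (ge_sub hv (ge_mono hw2 (by omega)) ?_) ?_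
        · exact ge_mono (ge_mul hv hμβ (ge_sq hv hw)) (by omega)
        · refine ge_mono (ge_mul hv (ge_add hv h1v (ge_mono hμβ (by omega)))
            (ge_mul hv he.ge (ge_mul hv ht0 hw))) (by omega)
    · obtain ⟨c, hc⟩ := hbodd
      obtain ⟨w, hw, hw2⟩ := exists_sqrt_step hv he he0 ((κ - (1 + μ ^ 2 * β) * t ^ 2) * β⁻¹)
        (s - e + c + 1) (ge_mono (ge_mul hv hε (v_inv hv hβ).ge) (by omega))
      refine ⟨μ + w, t, ?_, ht, ?_⟩
      · exact v_add_eq hv hμ (ge_mono hw (by omega))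
      · have : κ - (1 + (μ + w) ^ 2 * β) * t ^ 2 =
          (((κ - (1 + μ ^ 2 * β) * t ^ 2) * β⁻¹ - w ^ 2) * β - (w ^ 2 * β) * ((t - 1) * (t + 1))) -
            (2 * (μ * w)) * (β * t ^ 2) := by field_simp; ring
        rw [this]
        refine ge_sub hv (ge_sub hv (ge_mono (ge_mul hv hw2 hβ.ge) (by omega)) ?_) ?_
        · exact ge_mono (ge_mul hv (ge_mul hv (ge_sq hv hw) hβ.ge)
            (ge_mul hv ht (ge_add hv ht0 h1v))) (by omega)
        · exact ge_mono (ge_mul hv (ge_mul hv he.ge (ge_mul hv hμ.ge hw))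
            (ge_mul hv hβ.ge (ge_sq hv ht0))) (by omega)

theorem v_unit (hv : DiscreteVal F v) {x : F} (hx : ((1 : ℤ) : WithTop ℤ) ≤ v (x - 1)) :
    v x = ((0 : ℤ) : WithTop ℤ) := by
  have h1 : v 1 = ((0 : ℤ) : WithTop ℤ) := by rw [v_one hv]; rfl
  have := v_add_eq hv h1 (ge_mono hx (by omega))
  rwa [add_sub_cancel] at this

theorem ne_of_v (hv : DiscreteVal F v) {x : F} {n : ℤ} (hx : v x = n) : x ≠ 0 := by
  rintro rfl
  rw [hv.1] at hx
  exact absurd hx WithTop.top_ne_coe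

theorem ge_of_root (hv : DiscreteVal F v) {z y : F} (h : z ^ 2 + z = y)
    (hy : ((0 : ℤ) : WithTop ℤ) ≤ v y) : ((0 : ℤ) : WithTop ℤ) ≤ v z := by
  by_cases hz : z = 0
  · rw [hz, hv.1]; exact le_top
  obtain ⟨n, hn⟩ := v_int hv hz
  rw [hn]
  by_contra hc
  have hc' : n < 0 := by
    by_contra h3
    exact hc (by exact_mod_cast (not_lt.1 h3))
  have h2 := v_add_eq hv (v_pow hv hn 2) (y := z) (by rw [hn]; norm_cast; push_cast; omega)
  rw [h] at h2
  rw [h2] at hy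
  have := WithTop.coe_le_coe.1 hy
  push_cast at this
  omega

/-- existence of a decomposition up to `1 + 4 x` -/
theorem decomp (hv : DiscreteVal F v) {e : ℤ} (he : v 2 = e) (he0 : 0 < e)
    {β : F} {a b : ℤ} (hβ : v β = (2 * e - b : ℤ)) (hbodd : Odd b) (hb2 : b < 2 * e)
    (ha0 : 0 < a) (hab : a ≤ b) {κ : F} (hκ : ((1 : ℤ) : WithTop ℤ) ≤ v (κ - 1))
    (hdef : HasQuadDefect v κ ((2 * e - a : ℤ) : WithTop ℤ)) :
    ∃ μ t x : F, v μ = (((b - a) / 2 : ℤ) : WithTop ℤ) ∧ ((1 : ℤ) : WithTop ℤ) ≤ v (t - 1) ∧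
      ((1 : ℤ) : WithTop ℤ) ≤ v (μ ^ 2 * β) ∧
      ((0 : ℤ) : WithTop ℤ) ≤ v x ∧ κ = (1 + μ ^ 2 * β) * (1 + 4 * x) * t ^ 2 := by
  obtain ⟨⟨k, hk⟩, hmax⟩ := hdef
  have hk1 : ((1 : ℤ) : WithTop ℤ) ≤ v (k ^ 2 * κ - 1) := ge_mono hk.ge (by omega)
  have hκu := v_unit hv hκ
  have hκ'u := v_unit hv hk1
  have h1v : v 1 = ((0 : ℤ) : WithTop ℤ) := by rw [v_one hv]; rfl
  have hk0 : k ≠ 0 := by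
    rintro rfl
    exact ne_of_v hv hκ'u (by ring)
  have hkv : v k = ((0 : ℤ) : WithTop ℤ) := by
    obtain ⟨n, hn⟩ := v_int hv hk0
    rw [hv.2.2.1, v_pow hv hn, hκu, ← WithTop.coe_add] at hκ'u
    have := WithTop.coe_injective hκ'u
    rw [hn]; congr 1; push_cast at this; omega
  have hksq : ((1 : ℤ) : WithTop ℤ) ≤ v ((k - 1) ^ 2) := by
    have : (k - 1) ^ 2 = (k ^ 2 * κ - 1) - k ^ 2 * (κ - 1) - 2 * (k - 1) := by ring
    rw [this]
    refine ge_sub hv (ge_sub hv hk1 ?_) ?_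
    · exact ge_mono (ge_mul hv (ge_sq hv hkv.ge) hκ) (by omega)
    · exact ge_mono (ge_mul hv he.ge (ge_sub hv hkv.ge h1v.ge)) (by omega)
  have hkone : ((1 : ℤ) : WithTop ℤ) ≤ v (k - 1) := by
    by_cases h0 : k - 1 = 0
    · rw [h0, hv.1]; exact le_top
    obtain ⟨n, hn⟩ := v_int hv h0
    rw [v_pow hv hn] at hksq
    rw [hn]
    have := WithTop.coe_le_coe.1 hksq
    apply WithTop.coe_le_coe.2
    push_cast at this
    omega
  have haodd : Odd a := by
    by_contra hc
    rw [Int.not_odd_iff_even] at hc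
    obtain ⟨c, hc⟩ := hc
    obtain ⟨s, hs, hs2⟩ := exists_sqrt_step hv he he0 _ (e - c) (ge_mono hk.ge (by omega))
    have hu : ((1 : ℤ) : WithTop ℤ) ≤ v ((1 + s) - 1) := by
      rw [add_sub_cancel_left]; exact ge_mono hs (by omega)
    have hu0 := v_unit hv hu
    have hne := ne_of_v hv hu0
    have h1 := hmax ⟨(1 + s)⁻¹ * k, rfl⟩
    have h2 : ((1 + s)⁻¹ * k) ^ 2 * κ - 1 =
        ((k ^ 2 * κ - 1 - s ^ 2) - 2 * s) * ((1 + s)⁻¹) ^ 2 := by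
      field_simp
      ring
    rw [h2] at h1
    have h3 := ge_mul hv (ge_sub hv hs2 (ge_mono (ge_mul hv he.ge hs) (by omega)))
      (ge_sq hv (v_inv hv hu0).ge)
    have := WithTop.coe_le_coe.1 (h3.trans h1)
    omega
  obtain ⟨c, hc⟩ := haodd
  obtain ⟨d, hd⟩ := id hbodd
  obtain ⟨μ, t, hμ, ht, hε⟩ := approx hv he he0 hβ hbodd hb2 (m := (b - a) / 2) (by omega) ha0 (by omega) hk
    (a - 1).toNat (by omega)
  have hμβ : ((1 : ℤ) : WithTop ℤ) ≤ v (μ ^ 2 * β) :=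
    ge_mono (ge_mul hv (ge_sq hv hμ.ge) hβ.ge) (by omega)
  have hε' := ge_mono hε (n := 2 * e) (by omega)
  have hU := v_unit hv (x := 1 + μ ^ 2 * β) (by rwa [add_sub_cancel_left])
  have htu := v_unit hv ht
  have hU0 := ne_of_v hv hU
  have ht0 := ne_of_v hv htu
  have h20 := ne_of_v hv he
  refine ⟨μ, t * k⁻¹, (k ^ 2 * κ - (1 + μ ^ 2 * β) * t ^ 2) * (2⁻¹ ^ 2 * ((1 + μ ^ 2 * β)⁻¹ * t⁻¹ ^ 2)),
    hμ, ?_, hμβ, ?_, ?_⟩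
  · have : t * k⁻¹ - 1 = ((t - 1) - (k - 1)) * k⁻¹ := by field_simp; ring
    rw [this]
    exact ge_mono (ge_mul hv (ge_sub hv ht hkone) (v_inv hv hkv).ge) (by omega)
  · exact ge_mono (ge_mul hv hε' (ge_mul hv (ge_sq hv (v_inv hv he).ge)
      (ge_mul hv (v_inv hv hU).ge (ge_sq hv (v_inv hv htu).ge)))) (by omega)
  · have h4 : (4 : F) = 2 ^ 2 := by norm_num
    rw [h4]
    generalize 1 + μ ^ 2 * β = U at *
    field_simp
    ring

end main
end OneUnit

/-- Lemma 2.2: Let `F` be a 2-adic field with maximal unramified subfield `T`,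
`β ∈ F` with `v_F β = 2 e_F - b`, `0 < b < 2 e_F`, `b` odd.  If `κ ∈ 1 + 𝔓_F` has
quadratic defect `2 e_F - a` with `0 < a ≤ b`, then there are `μ ∈ 𝒪_F` with
`v_F μ = (b - a)/2` and `λ ∈ 𝒪_T` (either `0` or with `z² + z = λ` irreducible over
`T`, i.e. having no root) such that `κ ≡ (1 + μ²β)(1 + 4λ)` modulo squares of
one-units `(1 + 𝔓_F)²`. -/
theorem one_unit_normal_form
    (F : Type*) [Field F] [Algebra ℚ_[2] F] [FiniteDimensional ℚ_[2] F]
    (vF : F → WithTop ℤ) (hvF : DiscreteVal F vF)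
    (eF : ℤ) (he : vF 2 = (eF : WithTop ℤ))
    (T : Type*) [Field T] [Algebra T F]
    (hTunram : ∀ a : T, a ≠ 0 → ∃ n : ℤ, vF (algebraMap T F a) = ((n * eF : ℤ) : WithTop ℤ))
    (hTres : ∀ x : F, (0 : WithTop ℤ) ≤ vF x →
      ∃ a : T, (0 : WithTop ℤ) < vF (x - algebraMap T F a))
    (β : F) (b : ℤ) (hβ : vF β = ((2 * eF - b : ℤ) : WithTop ℤ))
    (hb0 : 0 < b) (hb2 : b < 2 * eF) (hbodd : Odd b)
    (κ : F) (hκ : (0 : WithTop ℤ) < vF (κ - 1))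
    (a : ℤ) (ha0 : 0 < a) (hab : a ≤ b)
    (hκdef : HasQuadDefect vF κ ((2 * eF - a : ℤ) : WithTop ℤ)) :
    ∃ (μ : F) (lam : T),
      vF μ = (((b - a) / 2 : ℤ) : WithTop ℤ) ∧
      (lam = 0 ∨ ∀ z : T, z ^ 2 + z ≠ lam) ∧
      ∃ t : F, (0 : WithTop ℤ) < vF (t - 1) ∧
        κ = (1 + μ ^ 2 * β) * (1 + 4 * algebraMap T F lam) * t ^ 2 := by
  have he0 : 0 < eF := by omega
  obtain ⟨μ, t, x, hμ, ht, hμβ, hx, hκe⟩ := OneUnit.decomp hvF he he0 hβ hbodd hb2 ha0 hab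
    ((OneUnit.pos_iff hvF).1 hκ) hκdef
  obtain ⟨l, hl⟩ := hTres x (by exact_mod_cast hx)
  rw [OneUnit.pos_iff hvF] at hl
  have h1v : vF 1 = ((0 : ℤ) : WithTop ℤ) := by rw [OneUnit.v_one hvF]; rfl
  have hl0 : ((0 : ℤ) : WithTop ℤ) ≤ vF (algebraMap T F l) := by
    have := OneUnit.ge_sub hvF hx (OneUnit.ge_mono hl (by omega))
    rwa [sub_sub_cancel] at this
  have h4 : (4 : F) = 2 * 2 := by norm_num
  have h4l : ((1 : ℤ) : WithTop ℤ) ≤ vF ((1 + 4 * algebraMap T F l) - 1) := by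
    rw [add_sub_cancel_left, h4]
    exact OneUnit.ge_mono (OneUnit.ge_mul hvF (OneUnit.ge_mul hvF he.ge he.ge) hl0) (by omega)
  have hlu := OneUnit.v_unit hvF h4l
  have hlne := OneUnit.ne_of_v hvF hlu
  have hy : ((1 : ℤ) : WithTop ℤ) ≤ vF ((x - algebraMap T F l) * (1 + 4 * algebraMap T F l)⁻¹) :=
    OneUnit.ge_mono (OneUnit.ge_mul hvF hl (OneUnit.v_inv hvF hlu).ge) (by omega)
  obtain ⟨z, hz⟩ := OneUnit.exists_root hvF he he0 _ hy
  have hz0 := OneUnit.ge_of_root hvF hz (OneUnit.ge_mono hy (by omega))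
  have hprod : ∀ {p q : F}, ((1 : ℤ) : WithTop ℤ) ≤ vF (p - 1) → ((1 : ℤ) : WithTop ℤ) ≤ vF (q - 1) →
      ((1 : ℤ) : WithTop ℤ) ≤ vF (p * q - 1) := by
    intro p q hp hq
    have : p * q - 1 = (p - 1) * q + (q - 1) := by ring
    rw [this]
    exact OneUnit.ge_add hvF (OneUnit.ge_mono
      (OneUnit.ge_mul hvF hp (OneUnit.v_unit hvF hq).ge) (by omega)) hq
  have hone : ∀ {w : F}, ((0 : ℤ) : WithTop ℤ) ≤ vF w → ((1 : ℤ) : WithTop ℤ) ≤ vF ((1 + 2 * w) - 1) := by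
    intro w hw
    rw [add_sub_cancel_left]
    exact OneUnit.ge_mono (OneUnit.ge_mul hvF he.ge hw) (by omega)
  have hx4 : 1 + 4 * x = (1 + 4 * algebraMap T F l) * (1 + 2 * z) ^ 2 := by
    have h5 : (1 + 4 * algebraMap T F l) * (z ^ 2 + z) = x - algebraMap T F l := by
      rw [hz]; field_simp
    linear_combination (-4) * h5
  by_cases hroot : ∃ w : T, w ^ 2 + w = l
  · obtain ⟨w, hw⟩ := hroot
    have hw' : (algebraMap T F w) ^ 2 + algebraMap T F w = algebraMap T F l := by
      rw [← hw]; simp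
    have hw0 := OneUnit.ge_of_root hvF hw' hl0
    refine ⟨μ, 0, hμ, Or.inl rfl, (1 + 2 * algebraMap T F w) * (1 + 2 * z) * t, ?_, ?_⟩
    · rw [OneUnit.pos_iff hvF]
      exact hprod (hprod (hone hw0) (hone hz0)) ht
    · rw [hκe, hx4, ← hw', map_zero]; ring
  · push Not at hroot
    refine ⟨μ, l, hμ, Or.inr hroot, (1 + 2 * z) * t, ?_, ?_⟩
    · rw [OneUnit.pos_iff hvF]
      exact hprod (hone hz0) ht
    · rw [hκe, hx4]; ring
end

section
/- Let N/K be a fully ramified quaternion extension of 2-adic fields with biquadratic subfield M = N^⟨σ²⟩. Suppose M/K has two breaks b₁ < b₂ with G_{b₂} fixing K(√u), where M = K(√u, √v). Then b₁ is the break of K(√u)/K, b₂ is the break of M/K(√u), (b₁+b₂)/2 is the break of K(√uv)/K, and b₁ is the break of M/K(√uv). -/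
namespace DVaux

theorem par2 (A B : WithTop ℤ) (h : 2 • A = 2 • B + 1) : 2 • A = ⊤ := by
  cases A using WithTop.recTopCoe with
  | top => rfl
  | coe a =>
    cases B using WithTop.recTopCoe with
    | top => simpa [two_nsmul] using h
    | coe b =>
      exfalso
      have h' : ((a + a : ℤ) : WithTop ℤ) = ((b + b + 1 : ℤ) : WithTop ℤ) := by
        simpa [two_nsmul] using h
      have := WithTop.coe_injective h'
      omega

theorem par4 (A B : WithTop ℤ) (h : 4 • A = 4 • B + 2) : 4 • A = ⊤ := by
  have h4 : ∀ C : WithTop ℤ, 4 • C = (C + C) + (C + C) := by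
    intro C
    rw [show (4 : ℕ) = 2 * 2 from rfl, mul_nsmul, two_nsmul, two_nsmul]
  rw [h4, h4] at h
  rw [h4]
  cases A using WithTop.recTopCoe with
  | top => rfl
  | coe a =>
    cases B using WithTop.recTopCoe with
    | top => simpa using h
    | coe b =>
      exfalso
      have h' : ((a + a + (a + a) : ℤ) : WithTop ℤ) = ((b + b + (b + b) + 2 : ℤ) : WithTop ℤ) := by
        simpa using h
      have := WithTop.coe_injective h'
      omega

theorem v_zero {F : Type*} [Field F] {v : F → WithTop ℤ} (h : DiscreteVal F v) : v 0 = ⊤ := h.1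
theorem v_top {F : Type*} [Field F] {v : F → WithTop ℤ} (h : DiscreteVal F v) {x : F}
    (hx : v x = ⊤) : x = 0 := h.2.1 x hx
theorem v_mul {F : Type*} [Field F] {v : F → WithTop ℤ} (h : DiscreteVal F v) (x y : F) :
    v (x * y) = v x + v y := h.2.2.1 x y
theorem v_add {F : Type*} [Field F] {v : F → WithTop ℤ} (h : DiscreteVal F v) (x y : F) :
    min (v x) (v y) ≤ v (x + y) := h.2.2.2.1 x y

theorem v_int {F : Type*} [Field F] {v : F → WithTop ℤ} (h : DiscreteVal F v) {x : F}
    (hx : x ≠ 0) : ∃ n : ℤ, v x = n := by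
  have : v x ≠ ⊤ := fun h' => hx (v_top h h')
  obtain ⟨n, hn⟩ := WithTop.ne_top_iff_exists.1 this
  exact ⟨n, hn.symm⟩

theorem v_one {F : Type*} [Field F] {v : F → WithTop ℤ} (h : DiscreteVal F v) : v 1 = 0 := by
  obtain ⟨n, hn⟩ := v_int h (one_ne_zero (α := F))
  have := v_mul h 1 1
  rw [mul_one, hn] at this
  have h2 : n = n + n := by exact_mod_cast this
  have : n = 0 := by omega
  rw [hn, this]; rfl

theorem v_neg {F : Type*} [Field F] {v : F → WithTop ℤ} (h : DiscreteVal F v) (x : F) :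
    v (-x) = v x := by
  have h1 : v (-1) = 0 := by
    obtain ⟨n, hn⟩ := v_int h (neg_ne_zero.2 (one_ne_zero (α := F)))
    have := v_mul h (-1) (-1)
    rw [neg_mul_neg, mul_one, v_one h, hn] at this
    have h2 : 0 = n + n := by exact_mod_cast this
    have : n = 0 := by omega
    rw [hn, this]; rfl
  rw [neg_eq_neg_one_mul, v_mul h, h1, zero_add]

theorem v_sub_comm {F : Type*} [Field F] {v : F → WithTop ℤ} (h : DiscreteVal F v) (x y : F) :
    v (x - y) = v (y - x) := by rw [← v_neg h, neg_sub]

theorem add_lt {F : Type*} [Field F] {v : F → WithTop ℤ} (h : DiscreteVal F v) {x y : F}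
    (hxy : v x < v y) : v (x + y) = v x := by
  apply le_antisymm
  · by_contra hc
    push Not at hc
    have := v_add h (x + y) (-y)
    rw [v_neg h, add_neg_cancel_right] at this
    exact absurd (lt_of_lt_of_le (lt_min hc hxy) this) (lt_irrefl _)
  · have := v_add h x y
    rwa [min_eq_left hxy.le] at this

theorem add_min {F : Type*} [Field F] {v : F → WithTop ℤ} (h : DiscreteVal F v) {x y : F}
    (hxy : v x = v y → v x = ⊤) : v (x + y) = min (v x) (v y) := by
  rcases lt_trichotomy (v x) (v y) with h1 | h1 | h1
  · rw [add_lt h h1, min_eq_left h1.le]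
  · have hx := hxy h1
    have hy := h1 ▸ hx
    rw [v_top h hx, v_top h hy]; simp
  · rw [add_comm, add_lt h h1, min_eq_right h1.le]

theorem form {K L M : Type*} [Field K] [Field L] [Field M] [Algebra K L] [Algebra K M]
    [Algebra L M] [IsScalarTower K L M] (S : Set M) (hS : Algebra.adjoin K S = ⊤)
    (w : M) (c : L) (hw : w ^ 2 = algebraMap L M c)
    (hgen : ∀ m ∈ S, ∃ a b : L, m = algebraMap L M a + algebraMap L M b * w) (m : M) :
    ∃ a b : L, m = algebraMap L M a + algebraMap L M b * w := by
  have hm : m ∈ Algebra.adjoin K S := by rw [hS]; trivial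
  induction hm using Algebra.adjoin_induction with
  | mem x hx => exact hgen x hx
  | algebraMap r => exact ⟨algebraMap K L r, 0, by simp [← IsScalarTower.algebraMap_apply]⟩
  | add x y _ _ hx hy =>
    obtain ⟨a, b, rfl⟩ := hx
    obtain ⟨a', b', rfl⟩ := hy
    exact ⟨a + a', b + b', by simp only [map_add]; ring⟩
  | mul x y _ _ hx hy =>
    obtain ⟨a, b, rfl⟩ := hx
    obtain ⟨a', b', rfl⟩ := hy
    refine ⟨a * a' + b * b' * c, a * b' + b * a', ?_⟩
    simp only [map_add, map_mul, ← hw]; ring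

/-- Parity formula for valuations in a ramified quadratic extension. -/
theorem parity {K L : Type*} [Field K] [Field L] [Algebra K L] {vK : K → WithTop ℤ}
    {vL : L → WithTop ℤ} (hL : DiscreteVal L vL)
    (hram : ∀ a : K, vL (algebraMap K L a) = 2 • vK a) {y : L} (hy : vL y = 1) (a b : K) :
    vL (algebraMap K L a + algebraMap K L b * y) = min (2 • vK a) (2 • vK b + 1) := by
  rw [add_min hL, v_mul hL, hram, hram, hy]
  rw [v_mul hL, hram, hram, hy]
  exact par2 _ _

theorem eisen {K L : Type*} [Field K] [Field L] [Algebra K L] {vK : K → WithTop ℤ}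
    {vL : L → WithTop ℤ} (hK : DiscreteVal K vK) (hL : DiscreteVal L vL)
    (hram : ∀ a : K, vL (algebraMap K L a) = 2 • vK a) {y : L} (hy : vL y = 1)
    (t n : K) (hyy : y ^ 2 = algebraMap K L t * y - algebraMap K L n) :
    vK n = 1 ∧ 1 ≤ vK t := by
  have h1 := parity hL hram hy (-n) t
  have h2 : algebraMap K L (-n) + algebraMap K L t * y = y * y := by
    rw [map_neg, ← pow_two, hyy]; ring
  rw [h2, v_mul hL, hy, v_neg hK] at h1
  generalize vK n = N at *
  generalize vK t = T at *
  have h3 : ((2 : ℤ) : WithTop ℤ) = min (2 • N) (2 • T + 1) := by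
    rw [← h1]; rfl
  cases N using WithTop.recTopCoe with
  | top =>
    cases T using WithTop.recTopCoe with
    | top => simp [two_nsmul] at h3
    | coe a =>
      exfalso
      simp only [two_nsmul, WithTop.top_add, min_top_left] at h3
      have : (2 : ℤ) = a + a + 1 := by exact_mod_cast h3
      omega
  | coe b =>
    cases T using WithTop.recTopCoe with
    | top =>
      simp only [two_nsmul, WithTop.top_add, min_top_right] at h3
      have : (2 : ℤ) = b + b := by exact_mod_cast h3
      have : b = 1 := by omega
      subst this
      exact ⟨rfl, le_top⟩
    | coe a =>
      simp only [two_nsmul] at h3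
      have h4 : (2 : ℤ) = min (b + b) (a + a + 1) := by exact_mod_cast h3
      have h5 : b = 1 := by omega
      have h6 : 1 ≤ a := by omega
      subst h5
      exact ⟨rfl, by exact_mod_cast h6⟩

theorem basis {K L : Type*} [Field K] [Field L] [Algebra K L] {vK : K → WithTop ℤ}
    {vL : L → WithTop ℤ} (hK : DiscreteVal K vK)
    (hram : ∀ a : K, vL (algebraMap K L a) = 2 • vK a) (z : L) (c : K)
    (hz : z ^ 2 = algebraMap K L c)
    (hform : ∀ l : L, ∃ a b : K, l = algebraMap K L a + algebraMap K L b * z)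
    {y : L} (hy : vL y = 1) :
    (∀ l : L, ∃ a b : K, l = algebraMap K L a + algebraMap K L b * y) ∧
    ∃ t n : K, y ^ 2 = algebraMap K L t * y - algebraMap K L n := by
  obtain ⟨a0, b0, h0⟩ := hform y
  have hb0 : b0 ≠ 0 := by
    rintro rfl
    rw [map_zero, zero_mul, add_zero] at h0
    have := hram a0
    rw [← h0, hy] at this
    by_cases ha : a0 = 0
    · rw [ha, v_zero hK] at this
      simp [two_nsmul] at this
    · obtain ⟨m, hm⟩ := v_int hK ha
      rw [hm, two_nsmul] at this
      have : (1 : ℤ) = m + m := by exact_mod_cast this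
      omega
  have hb0' : algebraMap K L b0 ≠ 0 := by simpa using hb0
  constructor
  · intro l
    obtain ⟨a, b, rfl⟩ := hform l
    refine ⟨a - b * a0 / b0, b / b0, ?_⟩
    rw [h0]
    simp only [map_sub, map_div₀, map_mul]
    field_simp
    ring
  · refine ⟨2 * a0, a0 ^ 2 - b0 ^ 2 * c, ?_⟩
    rw [h0]
    simp only [map_sub, map_mul, map_pow, ← hz, map_ofNat]
    ring

theorem restrict {K L M : Type*} [Field K] [Field L] [Field M] [Algebra K L] [Algebra K M]
    [Algebra L M] [IsScalarTower K L M] {vK : K → WithTop ℤ}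
    {vL : L → WithTop ℤ} {vM : M → WithTop ℤ} (hK : DiscreteVal K vK) (hL : DiscreteVal L vL)
    (hM : DiscreteVal M vM)
    (hram : ∀ a : K, vL (algebraMap K L a) = 2 • vK a)
    (hram4 : ∀ a : K, vM (algebraMap K M a) = 4 • vK a) (z : L) (c : K)
    (hz : z ^ 2 = algebraMap K L c)
    (hform : ∀ l : L, ∃ a b : K, l = algebraMap K L a + algebraMap K L b * z)
    {y : L} (hy : vL y = 1) (l : L) : vM (algebraMap L M l) = 2 • vL l := by
  obtain ⟨hbas, t, n, hyy⟩ := basis hK hram z c hz hform hy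
  obtain ⟨hn, ht⟩ := eisen hK hL hram hy t n hyy
  have hmap : ∀ a : K, algebraMap L M (algebraMap K L a) = algebraMap K M a := fun a =>
    (IsScalarTower.algebraMap_apply K L M a).symm
  set Y := algebraMap L M y with hY
  have hYY : Y * (algebraMap K M t + -Y) = algebraMap K M n := by
    have := congrArg (algebraMap L M) hyy
    simp only [map_pow, map_sub, map_mul, hmap, ← hY] at this
    linear_combination -this
  have hval := congrArg vM hYY
  rw [v_mul hM, hram4, hn] at hval
  have ht4 : ((4 : ℤ) : WithTop ℤ) ≤ vM (algebraMap K M t) := by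
    rw [hram4]
    have := nsmul_le_nsmul_right ht 4
    refine le_trans (le_of_eq ?_) this
    rw [nsmul_one]; rfl
  have hval4 : vM Y + vM (algebraMap K M t + -Y) = ((4 : ℤ) : WithTop ℤ) := by
    rw [hval, nsmul_one]; rfl
  have hY0 : y ≠ 0 := by
    rintro rfl
    rw [v_zero hL] at hy
    simp at hy
  have hY0' : Y ≠ 0 := by simpa [hY] using hY0
  have hY2 : vM Y = ((2 : ℤ) : WithTop ℤ) := by
    obtain ⟨p, hp⟩ := v_int hM hY0'
    rcases lt_or_ge p 4 with h4 | h4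
    · have h5 : vM (-Y) < vM (algebraMap K M t) := by
        rw [v_neg hM, hp]
        exact lt_of_lt_of_le (by exact_mod_cast h4) ht4
      rw [add_comm (algebraMap K M t), add_lt hM h5, v_neg hM, hp] at hval4
      have : p + p = 4 := by exact_mod_cast hval4
      have : p = 2 := by omega
      rw [hp, this]
    · exfalso
      have h5 : ((4 : ℤ) : WithTop ℤ) ≤ vM (algebraMap K M t + -Y) := by
        refine le_trans (le_min ht4 ?_) (v_add hM _ _)
        rw [v_neg hM, hp]; exact_mod_cast h4
      have h6 : ((4 : ℤ) : WithTop ℤ) ≤ vM Y := by rw [hp]; exact_mod_cast h4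
      have h7 := add_le_add h6 h5
      rw [hval4] at h7
      have : (4 : ℤ) + 4 ≤ 4 := by exact_mod_cast h7
      omega
  have hY2' : vM Y = 2 := hY2
  obtain ⟨a, b, rfl⟩ := hbas l
  rw [parity hL hram hy, map_add, map_mul, hmap, hmap, ← hY, add_min hM, v_mul hM, hram4, hram4,
    hY2']
  · generalize vK a = A
    generalize vK b = B
    have h4 : ∀ C : WithTop ℤ, 4 • C = 2 • (2 • C) := fun C => by
      rw [← mul_nsmul]
    have h5 : 4 • B + 2 = 2 • (2 • B + 1) := by
      rw [h4, smul_add]; simp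
    rw [h5, h4 A]
    have hmono : Monotone (fun C : WithTop ℤ => 2 • C) := fun _ _ h => nsmul_le_nsmul_right h 2
    exact (hmono.map_min).symm
  · rw [v_mul hM, hram4, hram4, hY2']
    exact par4 _ _

theorem main {K L M : Type*} [Field K] [Field L] [Field M] [Algebra K L] [Algebra K M]
    [Algebra L M] [IsScalarTower K L M] {vK : K → WithTop ℤ}
    {vL : L → WithTop ℤ} {vM : M → WithTop ℤ} (hK : DiscreteVal K vK) (hL : DiscreteVal L vL)
    (hM : DiscreteVal M vM)
    (hram : ∀ a : K, vL (algebraMap K L a) = 2 • vK a)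
    (hram4 : ∀ a : K, vM (algebraMap K M a) = 4 • vK a) (z : L) (c : K)
    (hz : z ^ 2 = algebraMap K L c)
    (hadj : Algebra.adjoin K ({z} : Set L) = ⊤)
    (w : M) (d : K) (hw : w ^ 2 = algebraMap K M d)
    (S : Set M) (hS : Algebra.adjoin K S = ⊤)
    (hgen : ∀ m ∈ S, ∃ a b : L, m = algebraMap L M a + algebraMap L M b * w)
    (h s : M ≃ₐ[K] M) (hhz : h (algebraMap L M z) = algebraMap L M z) (hhw : h w = - w)
    (σ : L ≃ₐ[K] L) (hs : s (algebraMap L M z) = algebraMap L M (σ z))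
    {π : M} (hπ : vM π = 1) {y : L} (hy : vL y = 1) :
    vM (s π - π) + vM (s (h π) - π) = 2 • vL (σ y - y) := by
  have hmap : ∀ a : K, algebraMap L M (algebraMap K L a) = algebraMap K M a := fun a =>
    (IsScalarTower.algebraMap_apply K L M a).symm
  have hform : ∀ l : L, ∃ a b : K, l = algebraMap K L a + algebraMap K L b * z := by
    apply form (K := K) _ hadj z c hz
    intro m hm
    rw [Set.mem_singleton_iff] at hm
    exact ⟨0, 1, by simp [hm]⟩
  have hw' : w ^ 2 = algebraMap L M (algebraMap K L d) := by rw [hmap, hw]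
  have hformM := form S hS w (algebraMap K L d) hw' hgen
  have hr := restrict hK hL hM hram hram4 z c hz hform hy
  have hhL : ∀ l : L, h (algebraMap L M l) = algebraMap L M l := by
    intro l
    obtain ⟨a, b, rfl⟩ := hform l
    simp only [map_add, map_mul, hmap, AlgEquiv.commutes, hhz]
  have hsL : ∀ l : L, s (algebraMap L M l) = algebraMap L M (σ l) := by
    intro l
    obtain ⟨a, b, rfl⟩ := hform l
    simp only [map_add, map_mul, hmap, AlgEquiv.commutes, hs]
  obtain ⟨t, n, ht, hn⟩ : ∃ t n : L, π + h π = algebraMap L M t ∧ π * h π = algebraMap L M n := by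
    obtain ⟨a, b, hab⟩ := hformM π
    refine ⟨2 * a, a ^ 2 - b ^ 2 * algebraMap K L d, ?_, ?_⟩
    · rw [hab]
      simp only [map_add, map_mul, hhL, hhw, map_ofNat]
      ring
    · rw [hab]
      simp only [map_add, map_mul, hhL, hhw, map_sub, map_pow, ← hw']
      ring
  have hππ : π ^ 2 = algebraMap L M t * π - algebraMap L M n := by
    rw [← ht, ← hn]; ring
  obtain ⟨hvn, hvt⟩ := eisen hL hM hr hπ t n hππ
  obtain ⟨hbas, -⟩ := basis hK hram z c hz hform hvn
  have hΔ : ∀ a b : K, σ (algebraMap K L a + algebraMap K L b * n) -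
      (algebraMap K L a + algebraMap K L b * n) = algebraMap K L b * (σ n - n) := by
    intro a b
    simp only [map_add, map_mul, AlgEquiv.commutes]; ring
  -- the uniformizer y
  have h1 : vL (σ y - y) = vL (σ n - n) := by
    obtain ⟨a, b, hab⟩ := hbas y
    have hp := parity hL hram hvn a b
    rw [← hab, hy] at hp
    have hb : vK b = 0 := by
      generalize vK a = A at hp
      generalize vK b = B at hp
      cases A using WithTop.recTopCoe with
      | top =>
        cases B using WithTop.recTopCoe with
        | top => simp [two_nsmul] at hp
        | coe b =>
          simp only [two_nsmul, WithTop.top_add, min_top_left] at hp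
          have : (1 : ℤ) = b + b + 1 := by exact_mod_cast hp
          have : b = 0 := by omega
          rw [this]; rfl
      | coe a =>
        cases B using WithTop.recTopCoe with
        | top =>
          simp only [two_nsmul, WithTop.top_add, min_top_right] at hp
          have : (1 : ℤ) = a + a := by exact_mod_cast hp
          omega
        | coe b =>
          simp only [two_nsmul] at hp
          have : (1 : ℤ) = min (a + a) (b + b + 1) := by exact_mod_cast hp
          have : b = 0 := by omega
          rw [this]; rfl
    rw [hab, hΔ, v_mul hL, hram, hb]
    simp
  have h2 : vL (σ n - n) ≤ vL (σ t - t) := by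
    obtain ⟨a, b, hab⟩ := hbas t
    have hp := parity hL hram hvn a b
    rw [← hab] at hp
    rw [hp] at hvt
    have hb : 0 ≤ vK b := by
      have hvb : 1 ≤ 2 • vK b + 1 := le_trans hvt (min_le_right _ _)
      generalize vK b = B at hvb
      cases B using WithTop.recTopCoe with
      | top => exact le_top
      | coe b =>
        rw [two_nsmul] at hvb
        have : (1 : ℤ) ≤ b + b + 1 := by exact_mod_cast hvb
        have : 0 ≤ b := by omega
        exact_mod_cast this
    rw [hab, hΔ, v_mul hL, hram]
    have h3 : 0 ≤ 2 • vK b := nsmul_nonneg hb 2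
    exact le_add_of_nonneg_left h3
  have h3 : (s π - π) * (s (h π) - π) =
      algebraMap L M (σ n - n) + algebraMap L M (-(σ t - t)) * π := by
    have e1 := congrArg s ht
    have e2 := congrArg s hn
    rw [hsL, map_add] at e1
    rw [hsL, map_mul] at e2
    simp only [map_sub, map_neg]
    linear_combination e2 - π * e1 + hππ
  rw [← v_mul hM, h3, parity hM hr hπ, v_neg hL, h1, min_eq_left]
  calc 2 • vL (σ n - n) ≤ 2 • vL (σ t - t) := nsmul_le_nsmul_right h2 2
    _ ≤ _ := le_add_of_nonneg_right (by exact_mod_cast Int.one_nonneg)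

end DVaux

/-- Case (1) of §4: `M = K(√u, √v)` is a fully ramified biquadratic extension with two
breaks `b₁ < b₂`, and `G_{b₂} = ⟨σ₀⟩` fixes `K(√u)` (i.e. `σ₀ √u = √u`).  Then `b₁` is
the break of `K(√u)/K`, `b₂` is the break of `M/K(√u)`, `(b₁+b₂)/2` is the break of
`K(√uv)/K`, and `b₁` is the break of `M/K(√uv)` (witnessed by the automorphism `s₂` of
`M/K` fixing `√u·√v`).  Breaks of quadratic extensions are measured on uniformizers. -/
theorem subextension_breaks_two_break_case_one
    (K : Type*) [Field K] [Algebra ℚ_[2] K] [FiniteDimensional ℚ_[2] K]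
    (vK : K → WithTop ℤ) (hvK : DiscreteVal K vK)
    (eK : ℤ) (he : vK 2 = (eK : WithTop ℤ))
    -- the biquadratic extension M = K(√u, √v)
    (M : Type*) [Field M] [Algebra K M]
    (vM : M → WithTop ℤ) (hvM : DiscreteVal M vM)
    (hram : ∀ a : K, vM (algebraMap K M a) = 4 • vK a)
    (hbiquad : Nat.card (M ≃ₐ[K] M) = 4)
    (hexp2 : ∀ s : M ≃ₐ[K] M, s * s = 1)
    (u v : K) (x y : M) (hx : x ^ 2 = algebraMap K M u) (hy : y ^ 2 = algebraMap K M v)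
    (hadj : Algebra.adjoin K ({x, y} : Set M) = ⊤)
    (πM : M) (hπM : vM πM = 1)
    -- the two ramification breaks b₁ < b₂ of Gal(M/K), with G_{b₂} = ⟨σ₀⟩ fixing K(√u)
    (b₁ b₂ : ℤ) (hb : b₁ < b₂)
    (σ₀ : M ≃ₐ[K] M) (hσ₀ : σ₀ ≠ 1) (hσ₀x : σ₀ x = x)
    (hbreak₂ : vM (σ₀ πM - πM) = ((b₂ + 1 : ℤ) : WithTop ℤ))
    (hbreak₁ : ∀ s : M ≃ₐ[K] M, s ≠ 1 → s ≠ σ₀ →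
      vM (s πM - πM) = ((b₁ + 1 : ℤ) : WithTop ℤ))
    -- the automorphism of M/K fixing √(uv)
    (s₂ : M ≃ₐ[K] M) (hs₂x : s₂ x = -x) (hs₂y : s₂ y = -y)
    -- the intermediate field Lu = K(√u)
    (Lu : Type*) [Field Lu] [Algebra K Lu] [Algebra Lu M] [IsScalarTower K Lu M]
    (xu : Lu) (hxu : algebraMap Lu M xu = x)
    (hLuadj : Algebra.adjoin K ({xu} : Set Lu) = ⊤)
    (vLu : Lu → WithTop ℤ) (hvLu : DiscreteVal Lu vLu)
    (hLuram : ∀ a : K, vLu (algebraMap K Lu a) = 2 • vK a)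
    (πLu : Lu) (hπLu : vLu πLu = 1)
    (su : Lu ≃ₐ[K] Lu) (hsu : su xu = -xu)
    -- the intermediate field Luv = K(√(uv))
    (Luv : Type*) [Field Luv] [Algebra K Luv] [Algebra Luv M] [IsScalarTower K Luv M]
    (zuv : Luv) (hzuv : algebraMap Luv M zuv = x * y)
    (hLuvadj : Algebra.adjoin K ({zuv} : Set Luv) = ⊤)
    (vLuv : Luv → WithTop ℤ) (hvLuv : DiscreteVal Luv vLuv)
    (hLuvram : ∀ a : K, vLuv (algebraMap K Luv a) = 2 • vK a)
    (πLuv : Luv) (hπLuv : vLuv πLuv = 1)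
    (suv : Luv ≃ₐ[K] Luv) (hsuv : suv zuv = -zuv) :
    -- b₁ is the break of K(√u)/K
    vLu (su πLu - πLu) = ((b₁ + 1 : ℤ) : WithTop ℤ) ∧
    -- b₂ is the break of M/K(√u)
    vM (σ₀ πM - πM) = ((b₂ + 1 : ℤ) : WithTop ℤ) ∧
    -- (b₁ + b₂)/2 is the break of K(√uv)/K
    vLuv (suv πLuv - πLuv) = (((b₁ + b₂) / 2 + 1 : ℤ) : WithTop ℤ) ∧
    -- b₁ is the break of M/K(√uv)
    vM (s₂ πM - πM) = ((b₁ + 1 : ℤ) : WithTop ℤ) := by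
  have h2K : (2 : K) ≠ 0 := by
    intro h
    rw [h, DVaux.v_zero hvK] at he
    exact WithTop.top_ne_coe he
  have h2M : (2 : M) ≠ 0 := by
    intro h
    apply h2K
    apply (algebraMap K M).injective
    rw [map_ofNat, h, map_zero]
  have hext : ∀ s s' : M ≃ₐ[K] M, s x = s' x → s y = s' y → s = s' := by
    intro s s' h1 h2
    have : (s : M →ₐ[K] M) = (s' : M →ₐ[K] M) := by
      apply AlgHom.ext_of_adjoin_eq_top hadj
      rintro m (rfl | rfl)
      · exact h1
      · exact h2
    ext m
    exact DFunLike.congr_fun this m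
  have hsgn : ∀ s : M ≃ₐ[K] M, s y = y ∨ s y = -y := by
    intro s
    apply sq_eq_sq_iff_eq_or_eq_neg.1
    rw [← map_pow, hy, AlgEquiv.commutes]
  have hσ₀y : σ₀ y = -y := by
    rcases hsgn σ₀ with h | h
    · exact absurd (hext σ₀ 1 hσ₀x h) hσ₀
    · exact h
  have hx0 : x ≠ 0 := by
    intro h0
    have hall : ∀ s : M ≃ₐ[K] M, s = 1 ∨ s = σ₀ := by
      intro s
      rcases hsgn s with h | h
      · exact Or.inl (hext _ _ (by simp [h0]) h)
      · exact Or.inr (hext _ _ (by simp [h0]) (by rw [h, hσ₀y]))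
    have hc : (Set.univ : Set (M ≃ₐ[K] M)) ⊆ {1, σ₀} := fun s _ => hall s
    have h4 := Set.ncard_le_ncard hc (Set.toFinite _)
    rw [Set.ncard_univ, hbiquad] at h4
    have := Set.ncard_insert_le (1 : M ≃ₐ[K] M) {σ₀}
    rw [Set.ncard_singleton] at this
    omega
  have hxne : -x ≠ x := by
    intro h
    have : 2 * x = 0 := by linear_combination -h
    rcases mul_eq_zero.1 this with h | h
    · exact h2M h
    · exact hx0 h
  have hs₂1 : s₂ ≠ 1 := by
    rintro rfl
    exact hxne hs₂x.symm
  have hs₂σ : s₂ ≠ σ₀ := by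
    rintro rfl
    exact hxne (hs₂x.symm.trans hσ₀x)
  have hB₂ := hbreak₁ s₂ hs₂1 hs₂σ
  have hp1 : s₂ * σ₀ ≠ 1 := by
    intro h
    apply hs₂σ
    have := mul_eq_one_iff_eq_inv.1 h
    rw [this]
    exact (mul_eq_one_iff_eq_inv.1 (hexp2 σ₀)).symm
  have hp2 : s₂ * σ₀ ≠ σ₀ := by
    intro h
    exact hs₂1 (mul_eq_right.1 h)
  have hq1 : σ₀ * s₂ ≠ 1 := by
    intro h
    apply hs₂σ
    exact ((mul_eq_one_iff_eq_inv.1 (hexp2 σ₀)).trans (mul_eq_one_iff_inv_eq.1 h)).symm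
  have hq2 : σ₀ * s₂ ≠ σ₀ := by
    intro h
    exact hs₂1 (mul_eq_left.1 h)
  have hBp : vM (s₂ (σ₀ πM) - πM) = ((b₁ + 1 : ℤ) : WithTop ℤ) := hbreak₁ _ hp1 hp2
  have hBq : vM (σ₀ (s₂ πM) - πM) = ((b₁ + 1 : ℤ) : WithTop ℤ) := hbreak₁ _ hq1 hq2
  have hdiv : ∀ (A : WithTop ℤ) (m r : ℤ), ((m : ℤ) : WithTop ℤ) = 2 • A → m = 2 * r ∨ r = m / 2 →
      A = (r : WithTop ℤ) := by
    intro A m r h1 h2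
    cases A using WithTop.recTopCoe with
    | top => simp [two_nsmul] at h1
    | coe a =>
      rw [two_nsmul] at h1
      have : m = a + a := by exact_mod_cast h1
      have : a = r := by omega
      rw [this]
  have hu : xu ^ 2 = algebraMap K Lu u := by
    apply (algebraMap Lu M).injective
    rw [map_pow, hxu, hx, ← IsScalarTower.algebraMap_apply]
  have huv : zuv ^ 2 = algebraMap K Luv (u * v) := by
    apply (algebraMap Luv M).injective
    rw [map_pow, hzuv, mul_pow, hx, hy, ← IsScalarTower.algebraMap_apply, map_mul]
  refine ⟨?_, hbreak₂, ?_, hB₂⟩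
  · have := DVaux.main hvK hvLu hvM hLuram hram xu u hu hLuadj y v hy _ hadj
      (by
        rintro m (rfl | rfl)
        · exact ⟨xu, 0, by simp [hxu]⟩
        · exact ⟨0, 1, by simp⟩)
      σ₀ s₂ (by rw [hxu, hσ₀x]) hσ₀y su (by rw [hxu, hs₂x, hsu, map_neg, hxu]) hπM hπLu
    rw [hB₂, hBp] at this
    exact hdiv _ _ _ (by rw [← this, WithTop.coe_add]) (Or.inl (two_mul (b₁ + 1)).symm)
  · have hu0 : algebraMap K M u ≠ 0 := by rw [← hx]; exact pow_ne_zero 2 hx0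
    have := DVaux.main hvK hvLuv hvM hLuvram hram zuv (u * v) huv hLuvadj x u hx _ hadj
      (by
        intro m hm
        rcases hm with h | h
        · exact ⟨0, 1, by simp [h]⟩
        · rw [Set.mem_singleton_iff] at h
          refine ⟨0, zuv * algebraMap K Luv u⁻¹, ?_⟩
          rw [h, map_zero, zero_add, map_mul, hzuv, ← IsScalarTower.algebraMap_apply, map_inv₀,
            ← hx]
          field_simp)
      s₂ σ₀ (by rw [hzuv, map_mul, hs₂x, hs₂y]; ring) hs₂x suv
      (by rw [hzuv, map_mul, hσ₀x, hσ₀y, hsuv, map_neg, hzuv]; ring) hπM hπLuv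
    rw [hbreak₂, hBq] at this
    refine hdiv _ ((b₂ + 1) + (b₁ + 1)) _ (by rw [← this]; rfl) (Or.inr ?_)
    omega
end
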